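/- For every w ∈ S_n and every β = (β_1,…,β_{n−1}) ∈ ℤ_{≥0}^{n−1}, the number of y^β-admissible directed paths in the quantum Bruhat graph Γ_n from w to the longest permutation w_o equals the number of y^β-admissible directed paths in Γ_n from the identity permutation to w_o·w. -/

import Mathlib

open Equiv

/-- Number of inversions of a permutation of `Fin n` (its Coxeter length). -/
def len (n : ℕ) (w : Equiv.Perm (Fin n)) : ℕ :=
  (Finset.univ.filter (fun p : Fin n × Fin n => p.1 < p.2 ∧ w p.2 < w p.1)).card

/-- The endpoint of the edge labeled `p = (i, j)` starting at `u`: right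
multiplication by the transposition `s_{ij}`. -/
def step (n : ℕ) (u : Equiv.Perm (Fin n)) (p : Fin n × Fin n) : Equiv.Perm (Fin n) :=
  u * Equiv.swap p.1 p.2

/-- `u → u·s_{ij}` is an edge of the quantum Bruhat graph `Γ_n`:
either `ℓ(u s_{ij}) = ℓ(u) + 1`, or `ℓ(u s_{ij}) = ℓ(u) + 1 - 2(j - i)`. -/
def isQBEdge (n : ℕ) (u : Equiv.Perm (Fin n)) (p : Fin n × Fin n) : Prop :=
  p.1 < p.2 ∧
    (len n (step n u p) = len n u + 1 ∨
     len n (step n u p) + 2 * ((p.2 : ℕ) - (p.1 : ℕ)) = len n u + 1)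

/-- The weight in `ℤ^{n-1}` of the edge labeled `p = (i,j)` starting at `u`:
`0` for a Bruhat cover, and `e_i + e_{i+1} + ⋯ + e_{j-1}` for a quantum edge.
(Here coordinates of `Fin (n-1)` are `0`-based: index `k` is the paper's `q_{k+1}`.) -/
def edgeWeight (n : ℕ) (u : Equiv.Perm (Fin n)) (p : Fin n × Fin n) : Fin (n - 1) → ℤ :=
  if len n (step n u p) = len n u + 1 then 0
  else fun k => if (p.1 : ℕ) ≤ (k : ℕ) ∧ (k : ℕ) < (p.2 : ℕ) then 1 else 0

/-- `isPath n u L v` : the list of labels `L` encodes a directed path from `u` to `v`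
in the quantum Bruhat graph `Γ_n`. -/
def isPath (n : ℕ) : Equiv.Perm (Fin n) → List (Fin n × Fin n) → Equiv.Perm (Fin n) → Prop
  | u, [], v => u = v
  | u, p :: ps, v => isQBEdge n u p ∧ isPath n (step n u p) ps v

/-- The weight of a directed path: the sum in `ℤ^{n-1}` of the weights of its edges. -/
def pathWeight (n : ℕ) : Equiv.Perm (Fin n) → List (Fin n × Fin n) → (Fin (n - 1) → ℤ)
  | _, [] => 0
  | u, p :: ps => edgeWeight n u p + pathWeight n (step n u p) ps

/-- Every edge of the path is length-increasing (a Bruhat cover). -/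
def allUp (n : ℕ) : Equiv.Perm (Fin n) → List (Fin n × Fin n) → Prop
  | _, [] => True
  | u, p :: ps => len n (step n u p) = len n u + 1 ∧ allUp n (step n u p) ps

/-- A path with labels `(a_1,b_1), …, (a_i,b_i)` is `y_k^i`-admissible if
`a_1 ≤ ⋯ ≤ a_i ≤ k < b_1, …, b_i` and the `b_t` are pairwise distinct.
(`k : Fin (n-1)` is `0`-based: it stands for the paper's `k+1`.) -/
def yAdm (n : ℕ) (k : Fin (n - 1)) (L : List (Fin n × Fin n)) : Prop :=
  List.Chain' (· ≤ ·) (L.map Prod.fst) ∧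
  (∀ p ∈ L, (p.1 : ℕ) ≤ (k : ℕ) ∧ (k : ℕ) < (p.2 : ℕ)) ∧
  (L.map Prod.snd).Nodup

/-- A path is `y^β`-admissible if it is a concatenation `P_1 ∘ ⋯ ∘ P_{n-1}` where
`P_k` is `y_k^{β_k}`-admissible. -/
def yBetaAdm (n : ℕ) (β : Fin (n - 1) → ℕ) (L : List (Fin n × Fin n)) : Prop :=
  ∃ Ls : Fin (n - 1) → List (Fin n × Fin n),
    L = (List.ofFn Ls).flatten ∧
    ∀ k : Fin (n - 1), (Ls k).length = β k ∧ yAdm n k (Ls k)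

/-- A path with labels `(a_1,b_1), …, (a_l,b_l)` is admissible if there are
`k_1 ≤ ⋯ ≤ k_l` with `a_t ≤ k_t < b_t` and the pairs `(k_t, b_t)` pairwise distinct. -/
def Adm (n : ℕ) (L : List (Fin n × Fin n)) : Prop :=
  ∃ ks : List ℕ, ks.length = L.length ∧ List.Chain' (· ≤ ·) ks ∧
    (∀ pr ∈ ks.zip L, (pr.2.1 : ℕ) ≤ pr.1 ∧ pr.1 < (pr.2.2 : ℕ)) ∧
    (ks.zip (L.map Prod.snd)).Nodup

/-- The longest permutation `w_o : i ↦ n + 1 - i` (0-based: `i ↦ n - 1 - i`). -/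
def wo (n : ℕ) : Equiv.Perm (Fin n) :=
  Function.Involutive.toPerm Fin.rev (fun i => Fin.rev_rev i)

/-- Functions on finite subsets, multiplied by the convolution
`(f * g) I = ∑_{U ⊆ I} f U * g (I \ U)`: the algebra obtained from `R` by adjoining
central variables `η_b`, `b ∈ ι`, with `η_b ^ 2 = 0`. -/
@[ext]
structure SetAlg (ι R : Type*) where
  /-- The coefficient of `∏_{b ∈ I} η_b`. -/
  coeff : Finset ι → R

namespace SetAlg

open Finset

instance {ι R : Type*} : CoeFun (SetAlg ι R) (fun _ => Finset ι → R) := ⟨coeff⟩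

variable {ι R : Type*} [Ring R]

instance : Zero (SetAlg ι R) := ⟨⟨fun _ => 0⟩⟩

instance : Add (SetAlg ι R) := ⟨fun f g => ⟨fun I => f I + g I⟩⟩

instance : Neg (SetAlg ι R) := ⟨fun f => ⟨fun I => -f I⟩⟩

@[simp] lemma zero_apply (I : Finset ι) : (0 : SetAlg ι R) I = 0 := rfl

@[simp] lemma add_apply (f g : SetAlg ι R) (I : Finset ι) : (f + g) I = f I + g I := rfl

@[simp] lemma neg_apply (f : SetAlg ι R) (I : Finset ι) : (-f) I = -f I := rfl

variable [DecidableEq ι]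

instance : Mul (SetAlg ι R) := ⟨fun f g => ⟨fun I => ∑ U ∈ I.powerset, f U * g (I \ U)⟩⟩

instance : One (SetAlg ι R) := ⟨⟨fun I => if I = ∅ then 1 else 0⟩⟩

lemma mul_apply (f g : SetAlg ι R) (I : Finset ι) :
    (f * g) I = ∑ U ∈ I.powerset, f U * g (I \ U) := rfl

lemma one_apply (I : Finset ι) : (1 : SetAlg ι R) I = if I = ∅ then 1 else 0 := rfl

protected lemma mul_assoc (f g h : SetAlg ι R) : f * g * h = f * (g * h) := by
  ext I
  simp only [mul_apply, sum_mul, mul_sum]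
  rw [sum_sigma', sum_sigma']
  refine sum_nbij' (fun x => ⟨x.2, x.1 \ x.2⟩) (fun x => ⟨x.1 ∪ x.2, x.1⟩) ?_ ?_ ?_ ?_ ?_
  · rintro ⟨U, V⟩ h
    simp only [mem_sigma, mem_powerset] at h ⊢
    exact ⟨h.2.trans h.1, sdiff_subset_sdiff h.1 le_rfl⟩
  · rintro ⟨U, V⟩ h
    simp only [mem_sigma, mem_powerset] at h ⊢
    exact ⟨union_subset h.1 (h.2.trans sdiff_subset), subset_union_left⟩
  · rintro ⟨U, V⟩ h
    simp only [mem_sigma, mem_powerset] at h ⊢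
    rw [union_sdiff_of_subset h.2]
  · rintro ⟨U, V⟩ h
    simp only [mem_sigma, mem_powerset] at h ⊢
    have : Disjoint U V := (disjoint_sdiff).mono_right h.2
    rw [union_sdiff_left, sdiff_eq_self_of_disjoint this.symm]
  · rintro ⟨U, V⟩ h
    simp only [mem_sigma, mem_powerset] at h ⊢
    rw [Finset.sdiff_sdiff_left', _root_.mul_assoc]
    congr 3
    ext x
    simp only [mem_sdiff, mem_inter]
    have := @h.2 x
    tauto

instance : Ring (SetAlg ι R) :=
  Ring.ofMinimalAxioms
    (fun f g h => by ext I; simp [add_assoc])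
    (fun f => by ext I; simp)
    (fun f => by ext I; simp)
    SetAlg.mul_assoc
    (fun f => by
      ext I
      rw [mul_apply, sum_eq_single ∅] <;> simp +contextual [one_apply])
    (fun f => by
      ext I
      rw [mul_apply, sum_eq_single I]
      · simp [one_apply]
      · intro U hU hne
        have : I \ U ≠ ∅ := fun h =>
          hne (subset_antisymm (mem_powerset.1 hU) (sdiff_eq_empty_iff_subset.1 h))
        simp [one_apply, this]
      · simp)
    (fun f g h => by
      ext I; simp only [mul_apply, add_apply, mul_add, sum_add_distrib])
    (fun f g h => by
      ext I; simp only [mul_apply, add_apply, add_mul, sum_add_distrib])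

/-- The element `x` of `R` as a constant. -/
def const : R →+* SetAlg ι R where
  toFun x := ⟨fun I => if I = ∅ then x else 0⟩
  map_zero' := by ext I; simp
  map_one' := rfl
  map_add' x y := by
    ext I
    by_cases h : I = ∅ <;> simp [h]
  map_mul' x y := by
    ext I
    rw [mul_apply, sum_eq_single ∅]
    · by_cases h : I = ∅ <;> simp [h]
    · intro U _ hU; simp [hU]
    · simp

lemma const_apply (x : R) (I : Finset ι) :
    (const x : SetAlg ι R) I = if I = ∅ then x else 0 := rfl

@[simp] lemma const_mul_apply (x : R) (f : SetAlg ι R) (I : Finset ι) :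
    (const x * f : SetAlg ι R) I = x * f I := by
  rw [mul_apply, sum_eq_single ∅] <;> simp +contextual [const_apply]

@[simp] lemma mul_const_apply (x : R) (f : SetAlg ι R) (I : Finset ι) :
    (f * const x : SetAlg ι R) I = f I * x := by
  rw [mul_apply, sum_eq_single I]
  · simp [const_apply]
  · intro U hU hne
    have : I \ U ≠ ∅ := fun h =>
      hne (subset_antisymm (mem_powerset.1 hU) (sdiff_eq_empty_iff_subset.1 h))
    simp [const_apply, this]
  · simp

/-- The square-zero central variable attached to `b`. -/
def eta (b : ι) : SetAlg ι R := ⟨fun I => if I = {b} then 1 else 0⟩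

lemma eta_mul_apply (b : ι) (f : SetAlg ι R) (I : Finset ι) :
    (eta b * f : SetAlg ι R) I = if b ∈ I then f (I.erase b) else 0 := by
  rw [mul_apply]
  split_ifs with h
  · rw [sum_eq_single {b}]
    · simp [eta, sdiff_singleton_eq_erase]
    · intro U _ hU; simp [eta, hU]
    · simp [h]
  · refine sum_eq_zero fun U hU => ?_
    have : U ≠ {b} := by
      rintro rfl; simp at hU; exact h hU
    simp [eta, this]

lemma mul_eta_apply (b : ι) (f : SetAlg ι R) (I : Finset ι) :
    (f * eta b : SetAlg ι R) I = if b ∈ I then f (I.erase b) else 0 := by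
  rw [mul_apply]
  split_ifs with h
  · rw [sum_eq_single (I.erase b)]
    · have : I \ I.erase b = {b} := by
        ext x; simp only [mem_sdiff, mem_erase, mem_singleton]
        constructor
        · tauto
        · rintro rfl; simpa using h
      simp [eta, this]
    · intro U hU hne
      have : I \ U ≠ {b} := by
        intro h'
        apply hne
        rw [mem_powerset] at hU
        rw [← sdiff_singleton_eq_erase, ← h', Finset.sdiff_sdiff_eq_self hU]
      simp [eta, this]
    · intro h'
      exact absurd (mem_powerset.2 (erase_subset b I)) h'
  · refine sum_eq_zero fun U hU => ?_
    have : I \ U ≠ {b} := by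
      intro h'
      have : b ∈ I \ U := by rw [h']; simp
      exact h (mem_sdiff.1 this).1
    simp [eta, this]

lemma eta_comm (b : ι) (f : SetAlg ι R) : Commute (eta b) f := by
  ext I
  rw [eta_mul_apply, mul_eta_apply]

@[simp] lemma eta_mul_eta_self (b : ι) : (eta b * eta b : SetAlg ι R) = 0 := by
  ext I
  rw [eta_mul_apply]
  split_ifs with h
  · have : I.erase b ≠ {b} := by
      intro h'
      have : b ∈ I.erase b := by rw [h']; simp
      simp at this
    simp [eta, this]
  · rfl

/-- Elements supported on subsets of `J`. -/
def supp (J : Finset ι) : Subring (SetAlg ι R) where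
  carrier := {f | ∀ I, ¬ I ⊆ J → f I = 0}
  zero_mem' := fun _ _ => rfl
  one_mem' := fun I h => by
    have : I ≠ ∅ := by rintro rfl; simp at h
    simp [one_apply, this]
  add_mem' := fun hf hg I h => by simp [hf I h, hg I h]
  neg_mem' := fun hf I h => by simp [hf I h]
  mul_mem' := fun {f g} hf hg I h => by
    rw [mul_apply]
    refine sum_eq_zero fun U hU => ?_
    by_cases h1 : U ⊆ J
    · by_cases h2 : I \ U ⊆ J
      · refine absurd ?_ h
        rw [← union_sdiff_of_subset (mem_powerset.1 hU)]
        exact union_subset h1 h2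
      · rw [hg _ h2, mul_zero]
    · rw [hf _ h1, zero_mul]

lemma const_mem_supp (J : Finset ι) (x : R) : (const x : SetAlg ι R) ∈ supp J := by
  intro I h
  have : I ≠ ∅ := by rintro rfl; simp at h
  simp [const_apply, this]

lemma eta_mem_supp {J : Finset ι} {b : ι} (hb : b ∈ J) : (eta b : SetAlg ι R) ∈ supp J := by
  intro I h
  have : I ≠ {b} := by rintro rfl; simp at h; exact h hb
  simp [eta, this]

variable [Fintype ι]

/-- The sum of the coefficients in degree `k`. -/
def coeffSum (k : ℤ) : SetAlg ι R →+ R where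
  toFun f := ∑ I ∈ univ.filter (fun I : Finset ι => (I.card : ℤ) = k), f I
  map_zero' := by simp
  map_add' f g := by simp [sum_add_distrib]

lemma coeffSum_apply (k : ℤ) (f : SetAlg ι R) :
    coeffSum k f = ∑ I ∈ univ.filter (fun I : Finset ι => (I.card : ℤ) = k), f I := rfl

lemma coeffSum_const_mul (k : ℤ) (x : R) (f : SetAlg ι R) :
    coeffSum k (const x * f) = x * coeffSum k f := by
  simp [coeffSum_apply, mul_sum]

lemma coeffSum_mul_const (k : ℤ) (x : R) (f : SetAlg ι R) :
    coeffSum k (f * const x) = coeffSum k f * x := by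
  simp [coeffSum_apply, sum_mul]

lemma coeffSum_one (k : ℤ) : coeffSum k (1 : SetAlg ι R) = if k = 0 then 1 else 0 := by
  rw [coeffSum_apply, sum_filter, sum_eq_single ∅]
  · simp [one_apply, eq_comm]
  · intro I _ hI; simp [one_apply, hI]
  · simp

lemma coeffSum_eta_mul (k : ℤ) {b : ι} {J : Finset ι} (hb : b ∉ J) {f : SetAlg ι R}
    (hf : f ∈ supp J) : coeffSum k (eta b * f) = coeffSum (k - 1) f := by
  rw [coeffSum_apply, coeffSum_apply]
  simp only [eta_mul_apply]
  rw [← sum_filter]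
  have h0 : ∀ I : Finset ι, b ∈ I → f I = 0 := fun I hI => hf I fun h => hb (h hI)
  rw [← sum_filter_add_sum_filter_not (univ.filter (fun I : Finset ι => (I.card : ℤ) = k - 1))
    (fun I => b ∈ I), sum_eq_zero (fun I hI => h0 I (mem_filter.1 hI).2), zero_add]
  refine sum_nbij' (fun I => I.erase b) (fun I => insert b I) ?_ ?_ ?_ ?_ ?_
  · intro I hI
    simp only [mem_filter, mem_univ, true_and] at hI ⊢
    have := card_erase_add_one hI.2
    refine ⟨by omega, by simp⟩
  · intro I hI
    simp only [mem_filter, mem_univ, true_and] at hI ⊢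
    have := card_insert_of_notMem hI.2
    refine ⟨by omega, by simp⟩
  · intro I hI
    exact insert_erase (mem_filter.1 hI).2
  · intro I hI
    exact erase_insert (mem_filter.1 hI).2
  · intros; rfl

end SetAlg

/-- A family `τ i j` satisfying the relations of the quantum Fomin–Kirillov algebra with
integer quantum parameters `p i j`. -/
structure IsBracketFamily {ι S : Type*} [Ring S] (τ : ι → ι → S) (p : ι → ι → ℤ) : Prop where
  self : ∀ i, τ i i = 0
  anti : ∀ i j, τ i j = -τ j i
  sq : ∀ i j, i ≠ j → τ i j * τ i j = (p i j : S)
  comm : ∀ i j k l, i ≠ k → i ≠ l → j ≠ k → j ≠ l → Commute (τ i j) (τ k l)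
  bracket : ∀ c x y, c ≠ x → c ≠ y → x ≠ y → τ c x * τ c y = τ x y * τ c x - τ c y * τ x y

lemma IsBracketFamily.map {ι S S' : Type*} [Ring S] [Ring S'] {τ : ι → ι → S} {p : ι → ι → ℤ}
    (h : IsBracketFamily τ p) (f : S →+* S') : IsBracketFamily (fun i j => f (τ i j)) p where
  self i := by simp [h.self i]
  anti i j := by rw [h.anti i j, map_neg]
  sq i j hij := by rw [← map_mul, h.sq i j hij, map_intCast]
  comm i j k l h1 h2 h3 h4 := (h.comm i j k l h1 h2 h3 h4).map f
  bracket c x y h1 h2 h3 := by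
    simp only [← map_mul, h.bracket c x y h1 h2 h3, map_sub]

namespace Bracket

open Finset

variable {ι K S : Type*} [DecidableEq ι] [CommRing K] [Ring S] [Algebra K S]

section Words

variable (η : ι → K) (t : ι → ι → S)

/-- The weighted sum of the letters `t a b`, `b ∈ J`. -/
def letters (J : Finset ι) (a : ι) : S := ∑ b ∈ J, η b • t a b

/-- The weighted sum of all words in the letters `t a b`, `b ∈ J`. -/
noncomputable def words (J : Finset ι) (a : ι) : S := Ring.inverse (1 - letters η t J a)

end Words

variable {η : ι → K} {t : ι → ι → S} {p : ι → ι → ℤ} {J : Finset ι} {a j m : ι}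

lemma letters_insert (hj : j ∉ J) (a : ι) :
    letters η t (insert j J) a = η j • t a j + letters η t J a :=
  sum_insert hj

omit [DecidableEq ι] in
lemma words_eq_of_mul {f : S} (h1 : (1 - letters η t J a) * f = 1)
    (h2 : f * (1 - letters η t J a) = 1) : words η t J a = f :=
  Ring.inverse_unit (⟨1 - letters η t J a, f, h1, h2⟩ : Sˣ)

lemma one_sub_insert_mul (hη : ∀ b, η b * η b = 0) (hj : j ∉ J) {f : S}
    (h1 : (1 - letters η t J a) * f = 1) :
    (1 - letters η t (insert j J) a) * (f + η j • (f * t a j * f)) = 1 := by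
  have h2 : letters η t J a * f = f - 1 := by
    rw [← h1]; noncomm_ring
  have h3 : letters η t J a * (f * t a j * f) = f * t a j * f - t a j * f := by
    rw [← mul_assoc, ← mul_assoc, h2]; noncomm_ring
  simp only [letters_insert hj, sub_mul, add_mul, mul_add, h2, smul_mul_assoc, mul_smul_comm,
    h3, smul_add, smul_sub, smul_smul, hη, zero_smul, one_mul]
  module

lemma insert_mul_one_sub (hη : ∀ b, η b * η b = 0) (hj : j ∉ J) {f : S}
    (h1 : f * (1 - letters η t J a) = 1) :
    (f + η j • (f * t a j * f)) * (1 - letters η t (insert j J) a) = 1 := by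
  have h2 : f * letters η t J a = f - 1 := by
    rw [← h1]; noncomm_ring
  have h3 : (f * t a j * f) * letters η t J a = f * t a j * f - f * t a j := by
    rw [mul_assoc, h2]; noncomm_ring
  simp only [letters_insert hj, mul_sub, mul_add, add_mul, h2, smul_mul_assoc, mul_smul_comm,
    h3, smul_add, smul_sub, smul_smul, hη, zero_smul, mul_one]
  module

lemma isUnit_one_sub_letters (hη : ∀ b, η b * η b = 0) (t : ι → ι → S) (J : Finset ι) (a : ι) :
    IsUnit (1 - letters η t J a) := by
  induction J using Finset.induction_on with
  | empty => simp [letters]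
  | insert j J hj ih =>
    obtain ⟨u, hu⟩ := ih
    have h1 : (1 - letters η t J a) * (↑u⁻¹ : S) = 1 := by rw [← hu]; simp
    have h2 : (↑u⁻¹ : S) * (1 - letters η t J a) = 1 := by rw [← hu]; simp
    exact ⟨⟨_, _, one_sub_insert_mul hη hj h1, insert_mul_one_sub hη hj h2⟩, rfl⟩

lemma one_sub_letters_mul_words (hη : ∀ b, η b * η b = 0) (J : Finset ι) (a : ι) :
    (1 - letters η t J a) * words η t J a = 1 :=
  Ring.mul_inverse_cancel _ (isUnit_one_sub_letters hη t J a)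

lemma words_mul_one_sub_letters (hη : ∀ b, η b * η b = 0) (J : Finset ι) (a : ι) :
    words η t J a * (1 - letters η t J a) = 1 :=
  Ring.inverse_mul_cancel _ (isUnit_one_sub_letters hη t J a)

lemma letters_mul_words (hη : ∀ b, η b * η b = 0) (J : Finset ι) (a : ι) :
    letters η t J a * words η t J a = words η t J a - 1 := by
  rw [← one_sub_letters_mul_words hη (t := t) J a]; noncomm_ring

lemma words_mul_letters (hη : ∀ b, η b * η b = 0) (J : Finset ι) (a : ι) :
    words η t J a * letters η t J a = words η t J a - 1 := by
  rw [← words_mul_one_sub_letters hη (t := t) J a]; noncomm_ring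

omit [DecidableEq ι] in
@[simp] lemma words_empty : words η t ∅ a = 1 := by simp [words, letters]

lemma words_insert (hη : ∀ b, η b * η b = 0) (hj : j ∉ J) (a : ι) :
    words η t (insert j J) a
      = words η t J a + η j • (words η t J a * t a j * words η t J a) :=
  words_eq_of_mul (one_sub_insert_mul hη hj (one_sub_letters_mul_words hη J a))
    (insert_mul_one_sub hη hj (words_mul_one_sub_letters hη J a))

lemma commute_words (hη : ∀ b, η b * η b = 0) {f : S} (h : Commute f (letters η t J a)) :
    Commute f (words η t J a) := by
  obtain ⟨u, hu⟩ := isUnit_one_sub_letters hη t J a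
  have h1 : Commute f (u : S) := by
    rw [hu]; exact (Commute.one_right f).sub_right h
  have : words η t J a = (↑u⁻¹ : S) := by rw [words, ← hu, Ring.inverse_unit]
  rw [this]
  exact h1.units_inv_right

/-- A letter commutes with the words on disjoint indices; indices killed by `e` are ignored. -/
lemma commute_smul_words (ht : IsBracketFamily t p) (hη : ∀ b, η b * η b = 0) (e : K) {x y : ι}
    (hax : a ≠ x) (hay : a ≠ y) (hx : x ∉ J ∨ e * η x = 0) (hy : y ∉ J ∨ e * η y = 0) :
    Commute (e • t x y) (words η t J a) := by
  refine commute_words hη (Commute.sum_right _ _ _ fun b hb => ?_)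
  have key : ∀ z, z ∉ J ∨ e * η z = 0 → e * η b = 0 ∨ z ≠ b := by
    rintro z (hz | hz)
    · exact Or.inr fun h => hz (h ▸ hb)
    · by_cases h : z = b
      · exact Or.inl (h ▸ hz)
      · exact Or.inr h
  have zero : e * η b = 0 → Commute (e • t x y) (η b • t a b) := by
    intro h0
    rw [Commute, SemiconjBy, smul_mul_smul_comm, smul_mul_smul_comm, mul_comm (η b), h0]
    simp
  rcases key x hx with h0 | h1
  · exact zero h0
  rcases key y hy with h0 | h2
  · exact zero h0
  exact ((ht.comm x y a b hax.symm h1 hay.symm h2).smul_left e).smul_right (η b)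

lemma commute_letter_words (ht : IsBracketFamily t p) (hη : ∀ b, η b * η b = 0) {x y : ι}
    (hax : a ≠ x) (hay : a ≠ y) (hx : x ∉ J) (hy : y ∉ J) :
    Commute (t x y) (words η t J a) := by
  simpa using commute_smul_words ht hη (1 : K) hax hay (Or.inl hx) (Or.inl hy)

lemma commute_words_words (ht : IsBracketFamily t p) (hη : ∀ b, η b * η b = 0) {x : ι}
    (hax : a ≠ x) (hx : x ∉ J) (ha : a ∉ J) :
    Commute (words η t J x) (words η t J a) := by
  refine commute_words hη (Commute.symm (commute_words hη ?_))
  refine Commute.sum_left _ _ _ fun b hb => Commute.sum_right _ _ _ fun c hc => ?_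
  by_cases hbc : b = c
  · subst hbc
    rw [Commute, SemiconjBy, smul_mul_smul_comm, smul_mul_smul_comm, hη]
    simp
  · refine ((ht.comm _ _ _ _ hax ?_ ?_ hbc).smul_left _).smul_right _
    · rintro rfl; exact ha hc
    · rintro rfl; exact hx hb

/-! ### The cyclic relation -/

section Cyclic

/-- The words in the letters `t j b` in which exactly `m` is repeated, at the beginning and at
the end, summed over the cyclic rotations. -/
noncomputable def cyclicSum (η : ι → K) (t : ι → ι → S) (J : Finset ι) (j m : ι) : S :=
  t j m * words η t J j * t j m
    + ∑ b ∈ J, η b • (t j b * words η t J j * t j m * words η t J j * t j b)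

/-- The closed form of `cyclicSum`. -/
noncomputable def cyclicSum' (η : ι → K) (t : ι → ι → S) (p : ι → ι → ℤ) (J : Finset ι)
    (j m : ι) : S :=
  p j m • words η t J m
    + ∑ b ∈ J, η b • p j b • (words η t J b * t b m * words η t J b)

lemma smul_bracket (ht : IsBracketFamily t p) (hη : ∀ b, η b * η b = 0) (hj : j ∉ J)
    (hm : m ∈ J) {c : ι} (hc : c ∈ J) :
    (η m * η c) • (t j c * t j m) = (η m * η c) • (t c m * t j c - t j m * t c m) := by
  by_cases h : c = m
  · subst h; simp [hη]
  · rw [ht.bracket j c m (fun h => hj (h ▸ hc)) (fun h => hj (h ▸ hm)) h]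

lemma words_eq_one_add (hη : ∀ b, η b * η b = 0) (J : Finset ι) (a : ι) :
    words η t J a = 1 + ∑ c ∈ J, η c • (words η t J a * t a c) := by
  have := words_mul_letters hη (t := t) J a
  rw [letters, mul_sum] at this
  simp only [mul_smul_comm] at this
  rw [this]; abel

lemma smul_mul_words_mul (ht : IsBracketFamily t p) (hη : ∀ b, η b * η b = 0) (hj : j ∉ J)
    (hm : m ∈ J) (x : S) :
    η m • (x * words η t J j * t j m) = η m • (x * t j m)
      + ∑ c ∈ J, (η m * η c) • (x * t c m * words η t J j * t j c
          - x * words η t J j * t j m * t c m) := by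
  conv_lhs => rw [words_eq_one_add hη]
  simp only [mul_add, add_mul, mul_one, smul_add, mul_sum, sum_mul, smul_sum]
  congr 1
  refine sum_congr rfl fun c hc => ?_
  have h1 := smul_bracket ht hη hj hm hc
  have h2 : Commute ((η m * η c) • t c m) (words η t J j) :=
    commute_smul_words ht hη _ (fun h => hj (h ▸ hc)) (fun h => hj (h ▸ hm))
      (Or.inr (by rw [mul_assoc, hη, mul_zero])) (Or.inr (by rw [mul_right_comm, hη, zero_mul]))
  calc η m • (x * η c • (words η t J j * t j c) * t j m)
      = x * words η t J j * ((η m * η c) • (t j c * t j m)) := by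
        simp only [smul_mul_assoc, mul_smul_comm, mul_assoc, smul_smul]
    _ = x * (words η t J j * ((η m * η c) • t c m)) * t j c
        - (η m * η c) • (x * words η t J j * t j m * t c m) := by
        rw [h1]
        simp only [smul_mul_assoc, mul_smul_comm, mul_assoc, mul_sub, smul_sub]
    _ = _ := by
        rw [← h2.eq]
        simp only [smul_mul_assoc, mul_smul_comm, mul_assoc, smul_sub]

lemma smul_cyclicSum (ht : IsBracketFamily t p) (hη : ∀ b, η b * η b = 0) (hj : j ∉ J)
    (hm : m ∈ J) :
    η m • cyclicSum η t J j m = η m • (p j m : S)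
      + ∑ c ∈ J, (η m * η c) • (t c m * cyclicSum η t J j c - cyclicSum η t J j m * t c m) := by
  have hjm : j ≠ m := fun h => hj (h ▸ hm)
  -- the terms with `m` at both ends
  have h1 := smul_mul_words_mul ht hη hj hm (t j m)
  rw [ht.sq j m hjm] at h1
  -- the terms with `b` at both ends
  have h2 : ∀ b ∈ J,
      η m • η b • (t j b * words η t J j * t j m * words η t J j * t j b)
        = (η m * η b) • (t b m * t j b * words η t J j * t j b
            - t j m * t b m * words η t J j * t j b)
          + ∑ c ∈ J, (η m * η c) • η b • (
            t c m * (t j b * words η t J j * t j c * words η t J j * t j b)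
            - (t j b * words η t J j * t j m * words η t J j * t j b) * t c m) := by
    intro b hb
    have h3 := congrArg (fun z => η b • (z * words η t J j * t j b))
      (smul_mul_words_mul ht hη hj hm (t j b))
    simp only [add_mul, sum_mul, smul_add, smul_sum] at h3
    have h4 := congrArg (fun z => z * words η t J j * t j b) (smul_bracket ht hη hj hm hb)
    calc _ = η b • (η m • (t j b * words η t J j * t j m) * words η t J j * t j b) := by
          simp only [smul_mul_assoc, smul_smul]; rw [mul_comm]
      _ = _ := h3
      _ = _ := by
        congr 1
        · calc _ = (η m * η b) • (t j b * t j m) * words η t J j * t j b := by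
                simp only [smul_mul_assoc, smul_smul]; rw [mul_comm]
            _ = _ := h4
            _ = _ := by simp only [smul_mul_assoc, sub_mul]
        · refine sum_congr rfl fun c hc => ?_
          have hcj : j ≠ c := fun h => hj (h ▸ hc)
          have hbj : j ≠ b := fun h => hj (h ▸ hb)
          have k1 : (η m * η c * η b) • (t j b * t c m) = (η m * η c * η b) • (t c m * t j b) := by
            by_cases hbc : b = c
            · subst hbc; rw [mul_assoc, hη]; simp
            by_cases hbm : b = m
            · subst hbm; rw [mul_right_comm, hη]; simp
            rw [(ht.comm j b c m hcj hjm hbc hbm).eq]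
          have k2 : Commute ((η m * η c) • t c m) (words η t J j) :=
            commute_smul_words ht hη _ hcj hjm
              (Or.inr (by rw [mul_assoc, hη, mul_zero]))
              (Or.inr (by rw [mul_right_comm, hη, zero_mul]))
          set W := words η t J j
          have e1 : (η m * η c * η b) • (t j b * t c m * W * t j c * W * t j b)
              = (η m * η c * η b) • (t c m * t j b * W * t j c * W * t j b) := by
            have := congrArg (fun z => z * W * t j c * W * t j b) k1
            simpa only [smul_mul_assoc] using this
          have e2 : (η m * η c * η b) • (t j b * W * t j m * t c m * W * t j b)
              = (η m * η c * η b) • (t j b * W * t j m * W * t j b * t c m) := by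
            calc _ = η b • (t j b * W * t j m * (((η m * η c) • t c m) * W) * t j b) := by
                  simp only [smul_mul_assoc, mul_smul_comm, mul_assoc, smul_smul]
                  congr 1; ring
              _ = t j b * W * t j m * W * ((η m * η c * η b) • (t c m * t j b)) := by
                  rw [k2.eq]
                  simp only [smul_mul_assoc, mul_smul_comm, mul_assoc, smul_smul]
                  congr 1; ring
              _ = _ := by
                  rw [← k1]
                  simp only [mul_smul_comm, mul_assoc]
          calc _ = (η m * η c * η b) • (t j b * t c m * W * t j c * W * t j b)
                - (η m * η c * η b) • (t j b * W * t j m * t c m * W * t j b) := by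
                simp only [smul_mul_assoc, sub_mul, smul_sub, smul_smul]
                rw [mul_comm (η b)]
            _ = _ := by
                rw [e1, e2]
                simp only [smul_sub, smul_smul, mul_assoc]
  rw [cyclicSum, smul_add, h1, smul_sum, sum_congr rfl h2, sum_add_distrib, sum_comm, add_assoc,
    ← sum_add_distrib, ← sum_add_distrib]
  congr 1
  refine sum_congr rfl fun c hc => ?_
  rw [← smul_sum, ← smul_add, ← smul_add]
  congr 1
  simp only [cyclicSum, mul_add, add_mul, mul_sum, sum_mul, mul_smul_comm, smul_mul_assoc,
    smul_sub, sum_sub_distrib, mul_assoc]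
  abel

end Cyclic

lemma smul_words_mul_letter (ht : IsBracketFamily t p) (hη : ∀ b, η b * η b = 0)
    (hm : m ∈ J) (b : ι) :
    (η m * η b) • (words η t J b * t b m * words η t J b)
      = (η m * η b) • (t b m * words η t J b)
        + ∑ c ∈ J, (η m * η c) • η b • (t c m * (words η t J b * t b c * words η t J b)
            - words η t J b * t b m * words η t J b * t c m) := by
  by_cases hbm : b = m
  · subst hbm
    simp only [hη, zero_smul, zero_add]
    refine (sum_eq_zero fun c _ => ?_).symm
    rw [smul_smul, mul_right_comm, hη, zero_mul, zero_smul]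
  have key : ∀ c ∈ J, (η m * η b) • (η c • (words η t J b * t b c) * t b m * words η t J b)
      = (η m * η c) • η b • (t c m * (words η t J b * t b c * words η t J b)
            - words η t J b * t b m * words η t J b * t c m) := by
    intro c hc
    by_cases hbc : b = c
    · subst hbc
      rw [smul_mul_assoc, smul_mul_assoc, smul_smul, smul_smul, mul_assoc, hη, mul_zero, zero_smul,
        zero_smul]
    by_cases hcm : c = m
    · subst hcm
      rw [smul_mul_assoc, smul_mul_assoc, smul_smul, mul_right_comm, hη, zero_mul, zero_smul,
        zero_smul]
    have h2 : Commute ((η m * η c) • t c m) (words η t J b) :=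
      commute_smul_words ht hη _ hbc hbm
        (Or.inr (by rw [mul_assoc, hη, mul_zero])) (Or.inr (by rw [mul_right_comm, hη, zero_mul]))
    have h3 := ht.bracket b c m hbc hbm hcm
    set W := words η t J b
    calc _ = η b • (η m * η c) • (W * (t b c * t b m) * W) := by
          simp only [smul_mul_assoc, mul_assoc, smul_smul]
          congr 1; ring
      _ = η b • (((W * (η m * η c) • t c m) * t b c * W)
            - W * t b m * ((η m * η c) • t c m * W)) := by
          rw [h3]
          simp only [smul_mul_assoc, mul_smul_comm, mul_assoc, mul_sub, sub_mul, smul_sub]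
      _ = _ := by
          rw [show W * t b m * ((η m * η c) • t c m * W) = W * t b m * W * (η m * η c) • t c m by
            rw [h2.eq]; simp only [mul_assoc], ← h2.eq]
          simp only [smul_mul_assoc, mul_smul_comm, mul_assoc, smul_sub, smul_smul, mul_comm (η b)]
  calc _ = (η m * η b) • ((1 + ∑ c ∈ J, η c • (words η t J b * t b c)) * t b m * words η t J b) := by
        rw [← words_eq_one_add hη J b]
    _ = _ := by
      rw [add_mul, add_mul, one_mul, smul_add, sum_mul, sum_mul, smul_sum, sum_congr rfl key]

lemma smul_cyclicSum' (ht : IsBracketFamily t p) (hη : ∀ b, η b * η b = 0) (hm : m ∈ J) (j : ι) :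
    η m • cyclicSum' η t p J j m = η m • (p j m : S)
      + ∑ c ∈ J, (η m * η c) •
          (t c m * cyclicSum' η t p J j c - cyclicSum' η t p J j m * t c m) := by
  have h1 : η m • p j m • words η t J m = η m • (p j m : S)
      - ∑ c ∈ J, (η m * η c) • p j m • (words η t J m * t c m) := by
    conv_lhs => rw [words_eq_one_add hη J m]
    rw [smul_add, smul_add, zsmul_one, sub_eq_add_neg, ← sum_neg_distrib, smul_sum, smul_sum]
    congr 1
    refine sum_congr rfl fun c _ => ?_
    rw [ht.anti m c, mul_neg, smul_neg, smul_neg, smul_neg, smul_comm (p j m), smul_smul]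
  have h2 : ∀ b ∈ J, η m • η b • p j b • (words η t J b * t b m * words η t J b)
      = (η m * η b) • p j b • (t b m * words η t J b)
        + ∑ c ∈ J, (η m * η c) • η b • p j b • (t c m * (words η t J b * t b c * words η t J b)
            - words η t J b * t b m * words η t J b * t c m) := by
    intro b _
    have := congrArg (fun z => p j b • z) (smul_words_mul_letter ht hη hm b)
    simp only [smul_add, smul_sum] at this
    simpa only [smul_comm (p j b), smul_smul (η m) (η b)] using this
  rw [cyclicSum', smul_add, h1, smul_sum, sum_congr rfl h2, sum_add_distrib, sum_comm,
    sub_add_eq_add_sub, ← add_assoc]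
  simp only [mul_add, add_mul, mul_sum, sum_mul, mul_smul_comm, smul_mul_assoc,
    smul_sub, sum_sub_distrib, smul_add, sum_add_distrib, smul_sum, cyclicSum']
  abel

lemma smul_mul_words_insert_mul (hη : ∀ b, η b * η b = 0) (hm : m ∉ J) (a : ι) (x y : S) :
    η m • (x * words η t (insert m J) a * y) = η m • (x * words η t J a * y) := by
  rw [words_insert hη hm, mul_add, add_mul, smul_add, mul_smul_comm, smul_mul_assoc, smul_smul, hη,
    zero_smul, add_zero]

lemma smul_cyclicSum_insert (hη : ∀ b, η b * η b = 0) (hm : m ∉ J) (j : ι) :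
    η m • cyclicSum η t (insert m J) j m = η m • cyclicSum η t J j m := by
  simp only [cyclicSum, smul_add, sum_insert hm, smul_smul (η m) (η m), hη, zero_smul, zero_add,
    smul_sum, smul_mul_words_insert_mul hη hm]
  congr 1
  refine sum_congr rfl fun b _ => ?_
  rw [smul_comm (η m), smul_comm (η m), smul_mul_words_insert_mul hη hm,
    mul_assoc (t j b * _), mul_assoc (t j b * _), smul_mul_words_insert_mul hη hm]
  simp only [mul_assoc]

lemma smul_cyclicSum'_insert (hη : ∀ b, η b * η b = 0) (hm : m ∉ J) (j : ι) :
    η m • cyclicSum' η t p (insert m J) j m = η m • cyclicSum' η t p J j m := by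
  have h := fun a => smul_mul_words_insert_mul (t := t) hη hm a 1 1
  simp only [one_mul, mul_one] at h
  rw [cyclicSum', cyclicSum', sum_insert hm, smul_add, smul_add, smul_add, smul_smul (η m) (η m),
    hη, zero_smul, zero_add, smul_comm (η m) (p j m), h, smul_comm (p j m), smul_sum, smul_sum]
  congr 1
  refine sum_congr rfl fun b _ => ?_
  have h1 := smul_mul_words_insert_mul (t := t) hη hm b 1 (t b m * words η t (insert m J) b)
  have h2 := smul_mul_words_insert_mul (t := t) hη hm b (words η t J b * t b m) 1
  simp only [one_mul, mul_one, ← mul_assoc] at h1 h2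
  rw [smul_comm (η m), smul_comm (η m), smul_comm (η m), smul_comm (η m), h1, h2]


/-- Conjugating the words by the letters. -/
lemma sum_letter_mul_words_mul_letter (hη : ∀ b, η b * η b = 0)
    (hcyc : ∀ J j m, j ∉ J → m ∈ J →
      η m • cyclicSum η t J j m = η m • cyclicSum' η t p J j m) (hj : j ∉ J) :
    ∑ b ∈ J, η b • (t j b * words η t J j * t j b) = ∑ b ∈ J, η b • p j b • words η t J b := by
  induction J using Finset.induction_on with
  | empty => simp
  | insert m J hm ih =>
    rw [mem_insert, not_or] at hj
    have h := hcyc (insert m J) j m (by simp [hj.1, hj.2]) (mem_insert_self m J)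
    rw [smul_cyclicSum_insert hη hm, smul_cyclicSum'_insert hη hm] at h
    have h1 : ∑ b ∈ insert m J, η b • (t j b * words η t (insert m J) j * t j b)
        = ∑ b ∈ J, η b • (t j b * words η t J j * t j b) + η m • cyclicSum η t J j m := by
      rw [sum_insert hm, smul_mul_words_insert_mul hη hm, cyclicSum, smul_add, smul_sum,
        add_left_comm, ← sum_add_distrib]
      congr 1
      refine sum_congr rfl fun b _ => ?_
      rw [words_insert hη hm, smul_comm (η m), ← smul_add]
      simp only [mul_add, add_mul, mul_smul_comm, smul_mul_assoc, mul_assoc]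
    have h2 : ∑ b ∈ insert m J, η b • p j b • words η t (insert m J) b
        = ∑ b ∈ J, η b • p j b • words η t J b + η m • cyclicSum' η t p J j m := by
      have := smul_mul_words_insert_mul (t := t) hη hm m 1 1
      simp only [one_mul, mul_one] at this
      rw [sum_insert hm, smul_comm (η m) (p j m), this, cyclicSum', smul_add, smul_sum,
        add_left_comm, ← sum_add_distrib, smul_comm (η m) (p j m)]
      congr 1
      refine sum_congr rfl fun b _ => ?_
      rw [words_insert hη hm, smul_comm (η m) (η b), ← smul_add, smul_comm (η m) (p j b),
        ← smul_add]
    rw [h1, h2, ih hj.2, h]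

/-- The product of the elements `words η t J a` over `a ∈ C`. -/
noncomputable def wordsProd (η : ι → K) (t : ι → ι → S) (J : Finset ι) (C : List ι) : S :=
  (C.map (words η t J)).prod

variable {C : List ι}

omit [DecidableEq ι] in
lemma wordsProd_cons (η : ι → K) (t : ι → ι → S) (J : Finset ι) (a : ι) (C : List ι) :
    wordsProd η t J (a :: C) = words η t J a * wordsProd η t J C := by
  simp [wordsProd]

omit [DecidableEq ι] in
lemma commute_wordsProd {f : S} (h : ∀ a ∈ C, Commute f (words η t J a)) :
    Commute f (wordsProd η t J C) :=
  Commute.list_prod_right _ _ fun x hx => by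
    obtain ⟨a, ha, rfl⟩ := List.mem_map.1 hx
    exact h a ha

lemma wordsProd_insert (ht : IsBracketFamily t p) (hη : ∀ b, η b * η b = 0) (hj : j ∉ J)
    (hC : C.Nodup) (hCJ : ∀ a ∈ C, a ∉ insert j J) :
    wordsProd η t (insert j J) C = wordsProd η t J C
      + η j • ∑ a ∈ C.toFinset, wordsProd η t J C * t a j * words η t J a := by
  induction C with
  | nil => simp [wordsProd]
  | cons a C ih =>
    simp only [List.nodup_cons, List.mem_cons, forall_eq_or_imp, mem_insert, not_or] at hC hCJ ih
    rw [wordsProd_cons, wordsProd_cons, words_insert hη hj, ih hC.2 hCJ.2, List.toFinset_cons,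
      sum_insert (by simpa using hC.1), mul_add, add_mul, add_mul, smul_mul_smul_comm, hη,
      zero_smul, add_zero, smul_mul_assoc, mul_smul_comm, add_assoc, ← smul_add]
    have hne : ∀ b ∈ C, b ≠ a := fun b hb h => hC.1 (h ▸ hb)
    have h1 : Commute (words η t J a) (wordsProd η t J C) := commute_wordsProd fun b hb =>
      commute_words_words ht hη (hne b hb) hCJ.1.2 (hCJ.2 b hb).2
    have h2 : Commute (t a j) (wordsProd η t J C) := commute_wordsProd fun b hb =>
      commute_letter_words ht hη (hne b hb) (hCJ.2 b hb).1 hCJ.1.2 hj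
    congr 3
    · simp only [mul_assoc]
      rw [h1.eq, ← mul_assoc (t a j), h2.eq, mul_assoc]
    · simp only [mul_sum, mul_assoc]

lemma smul_wordsProd_insert (hη : ∀ b, η b * η b = 0) (hj : j ∉ J) (C : List ι) (x y : S) :
    η j • (x * wordsProd η t (insert j J) C * y) = η j • (x * wordsProd η t J C * y) := by
  induction C generalizing x with
  | nil => rfl
  | cons a C ih =>
    rw [wordsProd_cons, wordsProd_cons, ← mul_assoc, ih, ← mul_assoc, mul_assoc (_ * _),
      smul_mul_words_insert_mul hη hj, mul_assoc (_ * _)]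

lemma letter_mul_words (ht : IsBracketFamily t p) (hη : ∀ b, η b * η b = 0) (hj : j ∉ J)
    (ha : a ∉ J) (haj : a ≠ j) :
    t a j * words η t J a = words η t J j * t a j
      - words η t J j * (∑ b ∈ J, η b • (t a b * t j b)) * words η t J a := by
  have h : letters η t J j * t a j = t a j * letters η t J a + ∑ b ∈ J, η b • (t a b * t j b) := by
    rw [letters, letters, sum_mul, mul_sum, ← sum_add_distrib]
    refine sum_congr rfl fun b hb => ?_
    rw [smul_mul_assoc, mul_smul_comm, ← smul_add]
    congr 1
    have := ht.bracket j b a (fun h => hj (h ▸ hb)) haj.symm (fun h => ha (h ▸ hb))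
    rw [ht.anti j a, ht.anti b a] at this
    rw [← neg_inj, ← mul_neg, this]
    noncomm_ring
  have h1 : (1 - letters η t J j) * (t a j * words η t J a)
      = t a j - (∑ b ∈ J, η b • (t a b * t j b)) * words η t J a := by
    rw [sub_mul, one_mul, ← mul_assoc, h, add_mul, mul_assoc, letters_mul_words hη]
    noncomm_ring
  calc _ = words η t J j * ((1 - letters η t J j) * (t a j * words η t J a)) := by
        rw [← mul_assoc (words η t J j), words_mul_one_sub_letters hη, one_mul]
    _ = _ := by rw [h1, mul_sub, mul_assoc]

end Bracket

namespace SetAlg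

open Finset Bracket

variable {ι R : Type*} [DecidableEq ι] [Ring R]

/-- The variable `eta b` as an element of the center. -/
def etaCenter (R : Type*) [Ring R] (b : ι) : Subring.center (SetAlg ι R) :=
  ⟨eta b, Subring.mem_center_iff.2 fun f => ((eta_comm b f).eq).symm⟩

@[simp] lemma etaCenter_smul (b : ι) (f : SetAlg ι R) : etaCenter R b • f = eta b * f := rfl

lemma etaCenter_sq (b : ι) : etaCenter (ι := ι) R b * etaCenter R b = 0 :=
  Subtype.ext (eta_mul_eta_self b)

variable {τ : ι → ι → R} {p : ι → ι → ℤ}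

lemma isBracketFamily_const (h : IsBracketFamily τ p) :
    IsBracketFamily (fun a b => (const (τ a b) : SetAlg ι R)) p :=
  h.map const

/-- The element `words` of `SetAlg ι R`. -/
noncomputable abbrev W (τ : ι → ι → R) (J : Finset ι) (a : ι) : SetAlg ι R :=
  words (etaCenter R) (fun a b => const (τ a b)) J a

/-- Taking the coefficient of `I`. -/
def evalHom (I : Finset ι) : SetAlg ι R →+ R where
  toFun f := f I
  map_zero' := rfl
  map_add' _ _ := rfl

lemma eq_zero_of_recursion {J : Finset ι} {Δ : ι → SetAlg ι R}
    (h : ∀ m ∈ J, Δ m = ∑ c ∈ J,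
      (eta m * (const (τ c m) * Δ c) - eta c * (Δ m * const (τ c m)))) :
    ∀ m ∈ J, Δ m = 0 := by
  have key : ∀ (N : ℕ) (I : Finset ι), I.card = N → ∀ m ∈ J, Δ m I = 0 := by
    intro N
    induction N using Nat.strong_induction_on with
    | _ N ih =>
      intro I hI m hm
      have ih' : ∀ b ∈ I, ∀ c ∈ J, Δ c (I.erase b) = 0 := fun b hb c hc =>
        ih _ (hI ▸ card_erase_lt_of_mem hb) _ rfl c hc
      rw [h m hm]
      change evalHom I _ = 0
      rw [map_sum]
      refine sum_eq_zero fun c hc => ?_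
      rw [map_sub]
      change (eta m * (const (τ c m) * Δ c) : SetAlg ι R) I
        - (eta c * (Δ m * const (τ c m)) : SetAlg ι R) I = 0
      rw [eta_mul_apply, eta_mul_apply]
      split_ifs with h1 h2 h2
      · simp [ih' m h1 c hc, ih' c h2 m hm]
      · simp [ih' m h1 c hc]
      · simp [ih' c h2 m hm]
      · simp
  intro m hm
  ext I
  exact key _ I rfl m hm

lemma smul_cyclicSum_eq (ht : IsBracketFamily τ p) {J : Finset ι} {j m : ι} (hj : j ∉ J)
    (hm : m ∈ J) :
    etaCenter (ι := ι) R m • cyclicSum (etaCenter R) (fun a b => (const (τ a b) : SetAlg ι R)) J j m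
      = etaCenter R m • cyclicSum' (etaCenter R) (fun a b => (const (τ a b) : SetAlg ι R)) p J j m := by
  have ht' := isBracketFamily_const ht
  rw [← sub_eq_zero, ← smul_sub]
  refine eq_zero_of_recursion (τ := τ) (J := J) (Δ := fun m => etaCenter R m •
    (cyclicSum (etaCenter R) (fun a b => (const (τ a b) : SetAlg ι R)) J j m -
    cyclicSum' (etaCenter R) (fun a b => (const (τ a b) : SetAlg ι R)) p J j m)) ?_ m hm
  intro m hm
  refine (show _ = _ by
    rw [smul_sub, smul_cyclicSum ht' etaCenter_sq hj hm, smul_cyclicSum' ht' etaCenter_sq hm,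
      add_sub_add_left_eq_sub, ← sum_sub_distrib]).trans (sum_congr rfl fun c _ => ?_)
  simp only [← etaCenter_smul, mul_smul_comm, smul_mul_assoc, smul_smul]
  rw [mul_comm (etaCenter R c), ← smul_sub, ← smul_sub]
  congr 1
  noncomm_ring

lemma sum_letter_mul_W_mul_letter (ht : IsBracketFamily τ p) {J : Finset ι} {j : ι} (hj : j ∉ J) :
    ∑ b ∈ J, eta b * (const (τ j b) * W τ J j * const (τ j b))
      = ∑ b ∈ J, eta b * (p j b • W τ J b) :=
  sum_letter_mul_words_mul_letter etaCenter_sq (fun _ _ _ => smul_cyclicSum_eq ht) hj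

lemma W_mem_supp (τ : ι → ι → R) (J : Finset ι) (a : ι) : W τ J a ∈ supp J := by
  induction J using Finset.induction_on with
  | empty => rw [W, words_empty]; exact one_mem _
  | insert j J hj ih =>
    have hmono : ∀ f ∈ supp J, (f : SetAlg ι R) ∈ supp (insert j J) := fun f hf I hI =>
      hf I fun h => hI (h.trans (subset_insert j J))
    rw [W, words_insert etaCenter_sq hj, etaCenter_smul]
    exact add_mem (hmono _ ih) (mul_mem (eta_mem_supp (mem_insert_self j J))
      (hmono _ (mul_mem (mul_mem ih (const_mem_supp J _)) ih)))

/-- The product of the elements `W τ J a` over `a ∈ C`. -/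
noncomputable abbrev P (τ : ι → ι → R) (J : Finset ι) (C : List ι) : SetAlg ι R :=
  wordsProd (etaCenter R) (fun a b => const (τ a b)) J C

lemma P_mem_supp (τ : ι → ι → R) (J : Finset ι) (C : List ι) : P τ J C ∈ supp J :=
  list_prod_mem fun x hx => by
    obtain ⟨a, _, rfl⟩ := List.mem_map.1 hx
    exact W_mem_supp τ J a

variable {J : Finset ι} {j b : ι} {C : List ι}

lemma P_cons (τ : ι → ι → R) (J : Finset ι) (a : ι) (C : List ι) :
    P τ J (a :: C) = W τ J a * P τ J C := wordsProd_cons _ _ _ _ _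

lemma P_insert (ht : IsBracketFamily τ p) (hj : j ∉ J) (hC : C.Nodup)
    (hCJ : ∀ a ∈ C, a ∉ insert j J) :
    P τ (insert j J) C
      = P τ J C + eta j * ∑ a ∈ C.toFinset, P τ J C * const (τ a j) * W τ J a :=
  wordsProd_insert (isBracketFamily_const ht) etaCenter_sq hj hC hCJ

lemma eta_mul_P_insert_mul (hj : j ∉ J) (C : List ι) (y : SetAlg ι R) :
    eta j * (P τ (insert j J) C * y) = eta j * (P τ J C * y) := by
  simpa using smul_wordsProd_insert (etaCenter_sq (ι := ι) (R := R)) hj C 1 y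

lemma eta_mul_mul_W_insert (hj : j ∉ J) (a : ι) (x : SetAlg ι R) :
    eta j * (x * W τ (insert j J) a) = eta j * (x * W τ J a) := by
  simpa using smul_mul_words_insert_mul (etaCenter_sq (ι := ι) (R := R)) hj a x 1

lemma commute_W_P (ht : IsBracketFamily τ p) {a : ι} (ha : a ∉ J) (haC : a ∉ C)
    (hCJ : ∀ a ∈ C, a ∉ J) : Commute (W τ J a) (P τ J C) :=
  commute_wordsProd fun b hb => commute_words_words (isBracketFamily_const ht) etaCenter_sq
    (fun h => haC (h ▸ hb)) ha (hCJ b hb)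

variable [Fintype ι]

lemma coeffSum_P_mul_const (ht : IsBracketFamily τ p) (hb : b ∈ J) (hC : C.Nodup)
    (hCJ : ∀ a ∈ C, a ∉ J) (k : ℤ) (x : R) :
    coeffSum (k - 1) (P τ J C * const x) = coeffSum k (eta b * (P τ J C * const x))
      + ∑ a ∈ C.toFinset,
          coeffSum (k - 1) (eta b * (P τ J C * const (τ a b) * W τ J a * const x)) := by
  obtain ⟨J, hbJ, rfl⟩ : ∃ J', b ∉ J' ∧ insert b J' = J := ⟨J.erase b, by simp, insert_erase hb⟩
  have h : ∀ a, eta b * (P τ (insert b J) C * const (τ a b) * W τ (insert b J) a * const x)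
      = eta b * (P τ J C * const (τ a b) * W τ J a) * const x := by
    intro a
    rw [← mul_assoc, eta_mul_mul_W_insert hbJ, mul_assoc (P τ _ _),
      eta_mul_P_insert_mul hbJ]
    simp only [mul_assoc]
  rw [eta_mul_P_insert_mul hbJ,
    coeffSum_eta_mul k hbJ (mul_mem (P_mem_supp τ J C) (const_mem_supp J x)), ← map_sum]
  simp only [h]
  rw [← sum_mul, ← mul_sum, ← map_add, P_insert ht hbJ hC hCJ, add_mul]

lemma coeffSum_eta_mul_P_mul_W (ht : IsBracketFamily τ p) (hb : b ∈ J)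
    (hCJ : ∀ a ∈ C, a ∉ J) (k : ℤ) :
    coeffSum (k - 1) (eta b * (P τ J C * W τ J b))
      = coeffSum (k - 2) (P τ (J.erase b) (b :: C)) := by
  obtain ⟨J, hbJ, rfl⟩ : ∃ J', b ∉ J' ∧ insert b J' = J := ⟨J.erase b, by simp, insert_erase hb⟩
  rw [eta_mul_mul_W_insert hbJ, eta_mul_P_insert_mul hbJ, erase_insert hbJ, P_cons,
    (commute_W_P ht hbJ (fun h => hCJ b h (mem_insert_self b J))
      (fun a ha h => hCJ a ha (mem_insert_of_mem h))).eq,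
    coeffSum_eta_mul _ hbJ (mul_mem (P_mem_supp τ J C) (W_mem_supp τ J b))]
  congr 1; congr 1; ring

lemma coeffSum_P_insert (ht : IsBracketFamily τ p) (hj : j ∉ J) (hC : C.Nodup)
    (hCJ : ∀ a, a ∈ C ↔ a ∉ insert j J) (k : ℤ) :
    coeffSum k (P τ (insert j J) C) = coeffSum k (P τ J (j :: C))
      + coeffSum (k - 1) (P τ J (j :: C)) * (∑ a, τ a j)
      + ∑ b ∈ J, p j b • coeffSum (k - 2) (P τ (J.erase b) (b :: j :: C)) := by
  have ht' := isBracketFamily_const ht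
  have hjC : j ∉ C := fun h => (hCJ j).1 h (mem_insert_self j J)
  have hCJ' : ∀ a ∈ C, a ∉ J := fun a ha h => (hCJ a).1 ha (mem_insert_of_mem h)
  have hjCJ : ∀ a ∈ j :: C, a ∉ J := by
    simp only [List.mem_cons, forall_eq_or_imp]; exact ⟨hj, hCJ'⟩
  have hjCn : (j :: C).Nodup := List.nodup_cons.2 ⟨hjC, hC⟩
  have hE : P τ J (j :: C) = P τ J C * W τ J j := by
    rw [P_cons, (commute_W_P ht hj hjC hCJ').eq]
  set E := P τ J (j :: C) with hEdef
  -- expand the left-hand side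
  have h1 : coeffSum k (P τ (insert j J) C) = coeffSum k (P τ J C)
      + ∑ a ∈ C.toFinset, coeffSum (k - 1) (P τ J C * const (τ a j) * W τ J a) := by
    rw [P_insert ht hj hC fun a ha => (hCJ a).1 ha, map_add,
      coeffSum_eta_mul _ hj (sum_mem fun a _ =>
        mul_mem (mul_mem (P_mem_supp τ J C) (const_mem_supp J _)) (W_mem_supp τ J a)), map_sum]
  have h2 : ∀ a ∈ C.toFinset, coeffSum (k - 1) (P τ J C * const (τ a j) * W τ J a)
      = coeffSum (k - 1) E * τ a j - ∑ b ∈ J,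
        coeffSum (k - 1) (eta b * (E * const (τ a b) * W τ J a * const (τ j b))) := by
    intro a ha
    rw [List.mem_toFinset] at ha
    have haj : a ≠ j := fun h => hjC (h ▸ ha)
    rw [mul_assoc, W, letter_mul_words ht' etaCenter_sq hj (hCJ' a ha) haj, mul_sub, map_sub,
      ← mul_assoc, ← W, ← hE, coeffSum_mul_const, ← map_sum]
    congr 2
    rw [mul_assoc, ← mul_assoc, ← hE, sum_mul, mul_sum]
    refine sum_congr rfl fun b hb => ?_
    have := commute_smul_words (e := etaCenter (ι := ι) R b) (J := J) ht' etaCenter_sq haj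
      (fun h => hCJ' a ha (h ▸ hb)) (Or.inl hj) (Or.inr (etaCenter_sq b))
    calc E * (etaCenter R b • (const (τ a b) * const (τ j b)) * W τ J a)
        = E * const (τ a b) * (etaCenter R b • const (τ j b) * W τ J a) := by
          simp only [smul_mul_assoc, mul_smul_comm, mul_assoc]
      _ = _ := by
          rw [this.eq, ← etaCenter_smul]
          simp only [mul_smul_comm, mul_assoc]
  -- the letters with both indices outside of `C`
  have h3 : ∑ b ∈ J, coeffSum (k - 1) (E * const (τ j b))
      = coeffSum k E - coeffSum k (P τ J C)
        + ∑ b ∈ J, p j b • coeffSum (k - 2) (P τ (J.erase b) (b :: j :: C))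
        + ∑ a ∈ C.toFinset, ∑ b ∈ J,
          coeffSum (k - 1) (eta b * (E * const (τ a b) * W τ J a * const (τ j b))) := by
    rw [sum_congr rfl fun b hb => coeffSum_P_mul_const ht hb hjCn hjCJ k (τ j b),
      sum_add_distrib, add_assoc]
    congr 1
    · rw [← map_sum, ← map_sub]
      congr 1
      have := words_mul_letters (η := etaCenter R) (t := fun a b => (const (τ a b) : SetAlg ι R))
        etaCenter_sq J j
      rw [show E - P τ J C = P τ J C * (W τ J j - 1) by rw [hE]; noncomm_ring, ← this, letters,
        mul_sum, mul_sum]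
      refine sum_congr rfl fun b _ => ?_
      rw [← etaCenter_smul, ← hEdef, hE]
      simp only [mul_smul_comm, mul_assoc]
    · rw [sum_comm, List.toFinset_cons, sum_insert (by simpa using hjC)]
      congr 1
      rw [← map_sum]
      have h4 := congrArg (fun z => coeffSum (k - 1) (E * z)) (sum_letter_mul_W_mul_letter ht hj)
      simp only [mul_sum, map_sum] at h4
      calc _ = _ := ?_
        _ = _ := h4
        _ = _ := ?_
      · rw [map_sum]
        refine sum_congr rfl fun b _ => ?_
        congr 1
        simp only [← etaCenter_smul, mul_smul_comm, mul_assoc, hEdef]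
      · refine sum_congr rfl fun b hb => ?_
        rw [← coeffSum_eta_mul_P_mul_W ht hb hjCJ, ← map_zsmul]
        congr 1
        simp only [← etaCenter_smul, mul_smul_comm]
        rw [smul_comm]
  have h5 : ∑ a, τ a j = ∑ a ∈ C.toFinset, τ a j - ∑ b ∈ J, τ j b := by
    have hu : (univ : Finset ι) = insert j (C.toFinset ∪ J) := by
      ext a
      have := hCJ a
      simp only [mem_univ, mem_insert, mem_union, List.mem_toFinset, true_iff] at this ⊢
      tauto
    rw [hu, sum_insert (by simp [hjC, hj]), ht.self, zero_add, sum_union, sub_eq_add_neg,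
      ← sum_neg_distrib]
    · congr 1
      exact sum_congr rfl fun b _ => ht.anti b j
    · rw [Finset.disjoint_left]
      exact fun a ha => hCJ' a (List.mem_toFinset.1 ha)
  simp only [coeffSum_mul_const, ← mul_sum] at h3
  rw [h1, sum_congr rfl h2, h5, sum_sub_distrib, ← mul_sum, mul_sub, h3]
  abel

end SetAlg

namespace IsBracketFamily

open Finset

variable {ι R : Type*} [Ring R] {τ : ι → ι → R} {p : ι → ι → ℤ}

lemma sum_lie (h : IsBracketFamily τ p) {i j : ι} (hij : i ≠ j) (c : ι) :
    ⁅τ c i, τ c j⁆ + ⁅τ j i, τ c j⁆ + ⁅τ c i, τ i j⁆ = 0 := by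
  by_cases hci : c = i
  · subst hci
    simp [h.self, h.anti j c, Ring.lie_def]
  by_cases hcj : c = j
  · subst hcj
    simp [h.self, h.anti i c, Ring.lie_def]
  have h1 := h.bracket c i j hci hcj hij
  have h2 := h.bracket c j i hcj hci hij.symm
  simp only [Ring.lie_def, h1, h2, h.anti j i]
  noncomm_ring

variable [DecidableEq ι]

lemma lie_eq (h : IsBracketFamily τ p) {i j : ι} (hij : i ≠ j) (a b : ι) :
    ⁅τ a i, τ b j⁆ = (if a = b then ⁅τ a i, τ a j⁆ else 0)
      + (if a = j then ⁅τ j i, τ b j⁆ else 0) + (if b = i then ⁅τ a i, τ i j⁆ else 0) := by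
  by_cases hai : a = i
  · subst hai
    simp [h.self, hij, Ring.lie_def]
  by_cases hbj : b = j
  · subst hbj
    rcases eq_or_ne a b with rfl | hab <;> simp [h.self, hij.symm, Ring.lie_def, *]
  by_cases hab : a = b
  · subst hab
    simp [hai, hbj]
  by_cases haj : a = j
  · subst haj
    by_cases hbi : b = i
    · subst hbi
      simp [hab, h.anti a b, Ring.lie_def]
    · simp [hab, hbi]
  by_cases hbi : b = i
  · subst hbi
    simp [hab, haj]
  simp only [hab, haj, hbi, if_false, add_zero]
  exact commute_iff_lie_eq.1 (h.comm a i b j hab haj (Ne.symm hbi) hij)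

/-- The Dunkl elements commute. -/
lemma commute_sum [Fintype ι] (h : IsBracketFamily τ p) (i j : ι) :
    Commute (∑ a, τ a i) (∑ b, τ b j) := by
  by_cases hij : i = j
  · subst hij; exact Commute.refl _
  have h1 : ⁅∑ a, τ a i, ∑ b, τ b j⁆ = ∑ a, ∑ b, ⁅τ a i, τ b j⁆ := by
    simp only [Ring.lie_def, sum_sub_distrib, sum_mul_sum]
    rw [sum_comm (f := fun a b => τ b j * τ a i)]
  rw [commute_iff_lie_eq, h1, sum_congr rfl fun a _ => sum_congr rfl fun b _ => h.lie_eq hij a b]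
  simp only [sum_add_distrib, sum_ite_eq, sum_ite_eq', mem_univ, if_true, sum_ite_irrel, sum_const_zero]
  simp only [← sum_add_distrib, h.sum_lie hij, sum_const_zero]

end IsBracketFamily

namespace SetAlg

open Finset Bracket

variable {ι R : Type*} [DecidableEq ι] [Ring R] {τ : ι → ι → R} {p : ι → ι → ℤ}
  {J : Finset ι} {j b : ι} {C : List ι}

lemma P_reverse (ht : IsBracketFamily τ p) (hC : C.Nodup) (hCJ : ∀ a ∈ C, a ∉ J) :
    P τ J C.reverse = P τ J C := by
  refine (List.Perm.prod_eq' ((List.reverse_perm C).symm.map _) ?_).symm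
  rw [List.pairwise_map]
  exact hC.imp_of_mem fun {a b} ha hb hab =>
    commute_words_words (isBracketFamily_const ht) etaCenter_sq hab.symm (hCJ a ha) (hCJ b hb)

lemma P_empty (τ : ι → ι → R) (C : List ι) : P τ ∅ C = 1 :=
  List.prod_eq_one (by simp)

variable [Fintype ι]

lemma coeffSum_P_mem (ht : IsBracketFamily τ p) (hC : C.Nodup) (hCJ : ∀ a, a ∈ C ↔ a ∉ J) (k : ℤ) :
    coeffSum k (P τ J C) ∈ Subring.closure (Set.range fun j => ∑ a, τ a j) := by
  induction hN : J.card using Nat.strong_induction_on generalizing J C k with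
  | _ N ih =>
    rcases J.eq_empty_or_nonempty with rfl | ⟨j, hj⟩
    · rw [P_empty, coeffSum_one]
      split_ifs
      exacts [one_mem _, zero_mem _]
    · obtain ⟨J, hjJ, rfl⟩ : ∃ J', j ∉ J' ∧ insert j J' = J := ⟨J.erase j, by simp, insert_erase hj⟩
      rw [card_insert_of_notMem hjJ] at hN
      have hn : (j :: C).Nodup := List.nodup_cons.2 ⟨fun h => (hCJ j).1 h hj, hC⟩
      have hm : ∀ a, a ∈ j :: C ↔ a ∉ J := by
        intro a
        rw [List.mem_cons, hCJ, mem_insert]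
        by_cases h : a = j
        · simp [h, hjJ]
        · simp [h]
      rw [coeffSum_P_insert ht hjJ hC hCJ]
      refine add_mem (add_mem ?_ (mul_mem ?_ (Subring.subset_closure ⟨j, rfl⟩)))
        (sum_mem fun b hb => zsmul_mem ?_ _)
      · exact ih _ (by omega) hn hm _ rfl
      · exact ih _ (by omega) hn hm _ rfl
      · refine ih _ ?_ (List.nodup_cons.2 ⟨fun h => (hm b).1 h hb, hn⟩) ?_ _ rfl
        · have := card_erase_le (s := J) (a := b)
          omega
        · intro a
          rw [List.mem_cons, hm, mem_erase]
          by_cases h : a = b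
          · simp [h]
          · simp [h]

lemma commute_coeffSum_P (ht : IsBracketFamily τ p) {J' : Finset ι} {C' : List ι}
    (hC : C.Nodup) (hCJ : ∀ a, a ∈ C ↔ a ∉ J) (hC' : C'.Nodup) (hCJ' : ∀ a, a ∈ C' ↔ a ∉ J')
    (k l : ℤ) : Commute (coeffSum k (P τ J C)) (coeffSum l (P τ J' C')) := by
  have hcomm : ∀ x ∈ Set.range fun j => ∑ a, τ a j, ∀ y ∈ Set.range fun j => ∑ a, τ a j,
      x * y = y * x := by
    rintro _ ⟨i, rfl⟩ _ ⟨j, rfl⟩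
    exact ht.commute_sum i j
  have := Subring.isMulCommutative_closure hcomm
  exact congrArg Subtype.val (mul_comm' (⟨_, coeffSum_P_mem ht hC hCJ k⟩ :
    Subring.closure (Set.range fun j => ∑ a, τ a j)) ⟨_, coeffSum_P_mem ht hC' hCJ' l⟩)

/-! ### Expansion into words -/

section WordLists

omit [Ring R] [Fintype ι]

/-- The words of length `k` whose letters have their first indices in `C`, in the order given
by `C`, and have distinct second indices in `J`. -/
def wordLists : ℕ → List ι → Finset ι → Finset (List (ι × ι))
  | 0, _, _ => {[]}
  | _ + 1, [], _ => ∅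
  | k + 1, a :: C, J => wordLists (k + 1) C J ∪
      J.biUnion fun b => (wordLists k (a :: C) (J.erase b)).image (List.cons (a, b))
  termination_by k C => k + C.length

lemma mem_wordLists [LinearOrder ι] {k : ℕ} {C : List ι} (hC : C.Pairwise (· < ·)) {J : Finset ι}
    {L : List (ι × ι)} :
    L ∈ wordLists k C J ↔ L.length = k ∧ (L.map Prod.fst).Pairwise (· ≤ ·) ∧
      (∀ q ∈ L, q.1 ∈ C ∧ q.2 ∈ J) ∧ (L.map Prod.snd).Nodup := by
  induction k, C, J using wordLists.induct generalizing L with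
  | case1 C J =>
    rw [wordLists, mem_singleton, List.length_eq_zero_iff]
    exact ⟨by rintro rfl; simp, fun h => h.1⟩
  | case2 k J =>
    cases L with
    | nil => simp [wordLists]
    | cons q L =>
      simp only [wordLists, notMem_empty, false_iff]
      exact fun h => List.not_mem_nil (h.2.2.1 q List.mem_cons_self).1
  | case3 k a C J ih1 ih2 =>
    rw [wordLists, mem_union, mem_biUnion, ih1 (List.pairwise_cons.1 hC).2]
    have hlt := (List.pairwise_cons.1 hC).1
    constructor
    · rintro (⟨h1, h2, h3, h4⟩ | ⟨b, hb, h⟩)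
      · exact ⟨h1, h2, fun q hq => ⟨List.mem_cons_of_mem a (h3 q hq).1, (h3 q hq).2⟩, h4⟩
      · obtain ⟨L, hL, rfl⟩ := mem_image.1 h
        obtain ⟨h1, h2, h3, h4⟩ := (ih2 b hC).1 hL
        refine ⟨by simp [h1], ?_, ?_, ?_⟩
        · rw [List.map_cons, List.pairwise_cons]
          refine ⟨fun x hx => ?_, h2⟩
          obtain ⟨q, hq, rfl⟩ := List.mem_map.1 hx
          rcases List.mem_cons.1 (h3 q hq).1 with h | h
          · exact h.ge
          · exact (hlt _ h).le
        · simp only [List.mem_cons, forall_eq_or_imp, true_or, true_and]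
          exact ⟨hb, fun q hq => ⟨List.mem_cons.1 (h3 q hq).1, mem_of_mem_erase (h3 q hq).2⟩⟩
        · rw [List.map_cons, List.nodup_cons]
          refine ⟨fun hx => ?_, h4⟩
          obtain ⟨q, hq, rfl⟩ := List.mem_map.1 hx
          exact (mem_erase.1 (h3 q hq).2).1 rfl
    · rintro ⟨h1, h2, h3, h4⟩
      cases L with
      | nil => simp at h1
      | cons q L =>
        obtain ⟨x, b⟩ := q
        rw [List.map_cons, List.pairwise_cons] at h2
        rw [List.map_cons, List.nodup_cons] at h4
        have hx := h3 _ List.mem_cons_self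
        rcases List.mem_cons.1 hx.1 with h | h
        · right
          obtain rfl : x = a := h
          refine ⟨b, hx.2, mem_image_of_mem _ ((ih2 b hC).2 ⟨by simpa using h1, h2.2, ?_, h4.2⟩)⟩
          intro q hq
          have := h3 q (List.mem_cons_of_mem _ hq)
          exact ⟨this.1, mem_erase.2 ⟨fun h => h4.1 (List.mem_map.2 ⟨q, hq, h⟩), this.2⟩⟩
        · left
          refine ⟨h1, List.pairwise_cons.2 h2, ?_, List.nodup_cons.2 h4⟩
          intro q hq
          refine ⟨(List.mem_cons.1 (h3 q hq).1).resolve_left fun hqa => ?_, (h3 q hq).2⟩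
          rcases List.mem_cons.1 hq with rfl | hq
          · exact (hlt _ h).ne' hqa
          · have := h2.1 q.1 (List.mem_map.2 ⟨q, hq, rfl⟩)
            exact absurd (hlt _ h) (not_lt.2 (hqa ▸ this))

lemma fst_mem_of_mem_wordLists {k : ℕ} {C : List ι} {J : Finset ι} {L : List (ι × ι)}
    (hL : L ∈ wordLists k C J) : ∀ q ∈ L, q.1 ∈ C := by
  induction k, C, J using wordLists.induct generalizing L with
  | case1 => simp_all [wordLists]
  | case2 => simp_all [wordLists]
  | case3 k a C J ih1 ih2 =>
    rw [wordLists, mem_union, mem_biUnion] at hL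
    rcases hL with hL | ⟨b, hb, hL⟩
    · exact fun q hq => List.mem_cons_of_mem a (ih1 hL q hq)
    · obtain ⟨L, hL', rfl⟩ := mem_image.1 hL
      simp only [List.mem_cons, forall_eq_or_imp, true_or, true_and]
      intro q hq
      simpa using ih2 b hL' q hq

lemma sum_wordLists_cons {M : Type*} [AddCommMonoid M] {a : ι} (ha : a ∉ C) (k : ℕ)
    (J : Finset ι) (f : List (ι × ι) → M) :
    ∑ L ∈ wordLists (k + 1) (a :: C) J, f L = ∑ L ∈ wordLists (k + 1) C J, f L
      + ∑ b ∈ J, ∑ L ∈ wordLists k (a :: C) (J.erase b), f ((a, b) :: L) := by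
  rw [wordLists, sum_union, sum_biUnion]
  · congr 1
    refine sum_congr rfl fun b _ => ?_
    rw [sum_image]
    exact fun x _ y _ h => (List.cons.inj h).2
  · intro b _ c _ hbc
    rw [Function.onFun, Finset.disjoint_left]
    intro L h1 h2
    obtain ⟨L1, _, rfl⟩ := mem_image.1 h1
    obtain ⟨L2, _, h⟩ := mem_image.1 h2
    exact hbc (by simpa using (congrArg Prod.snd (List.cons.inj h).1).symm)
  · rw [Finset.disjoint_left]
    intro L h1 h2
    obtain ⟨b, _, h2⟩ := mem_biUnion.1 h2
    obtain ⟨L, _, rfl⟩ := mem_image.1 h2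
    exact ha (fst_mem_of_mem_wordLists h1 _ List.mem_cons_self)

end WordLists

lemma coeffSum_of_neg {k : ℤ} (hk : k < 0) (f : SetAlg ι R) : coeffSum k f = 0 := by
  rw [coeffSum_apply, filter_false_of_mem, sum_empty]
  intro I _; omega

lemma coeffSum_eta_mul_mul_P_mul (k : ℤ) (hb : b ∈ J) (C : List ι) {x y : SetAlg ι R}
    (hx : x ∈ supp (J.erase b)) (hy : y ∈ supp (J.erase b)) :
    coeffSum k (eta b * (x * P τ J C * y)) = coeffSum (k - 1) (x * P τ (J.erase b) C * y) := by
  have hbJ : b ∉ J.erase b := by simp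
  have h : eta b * (x * P τ J C * y) = eta b * (x * P τ (J.erase b) C * y) := by
    conv_lhs => rw [← insert_erase hb]
    exact smul_wordsProd_insert (etaCenter_sq (ι := ι) (R := R)) hbJ C x y
  rw [h, coeffSum_eta_mul k hbJ (mul_mem (mul_mem hx (P_mem_supp τ _ C)) hy)]

lemma coeffSum_P_cons (k : ℤ) (τ : ι → ι → R) (J : Finset ι) (a : ι) (C : List ι) :
    coeffSum k (P τ J (a :: C)) = coeffSum k (P τ J C)
      + ∑ b ∈ J, τ a b * coeffSum (k - 1) (P τ (J.erase b) (a :: C)) := by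
  have h : letters (etaCenter R) (fun a b => (const (τ a b) : SetAlg ι R)) J a * W τ J a
      = W τ J a - 1 := letters_mul_words etaCenter_sq J a
  rw [eq_sub_iff_add_eq'] at h
  rw [P_cons, ← h, add_mul, one_mul, mul_assoc, ← P_cons, letters, sum_mul, map_add, map_sum]
  congr 1
  refine sum_congr rfl fun b hb => ?_
  have := coeffSum_eta_mul_mul_P_mul (τ := τ) k hb (a :: C) (const_mem_supp _ (τ a b)) (one_mem _)
  rwa [mul_one, mul_one, coeffSum_const_mul, ← etaCenter_smul, ← smul_mul_assoc] at this

lemma coeffSum_P_concat (k : ℤ) (τ : ι → ι → R) (J : Finset ι) (a : ι) (C : List ι) :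
    coeffSum k (P τ J (C ++ [a])) = coeffSum k (P τ J C)
      + ∑ b ∈ J, coeffSum (k - 1) (P τ (J.erase b) (C ++ [a])) * τ a b := by
  have hP : ∀ J, P τ J (C ++ [a]) = P τ J C * W τ J a := by
    intro J; simp [P, wordsProd]
  have h : W τ J a * letters (etaCenter R) (fun a b => (const (τ a b) : SetAlg ι R)) J a
      = W τ J a - 1 := words_mul_letters etaCenter_sq J a
  rw [eq_sub_iff_add_eq'] at h
  rw [hP, ← h, mul_add, mul_one, ← mul_assoc, ← hP, letters, mul_sum, map_add, map_sum]
  congr 1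
  refine sum_congr rfl fun b hb => ?_
  have := coeffSum_eta_mul_mul_P_mul (τ := τ) k hb (C ++ [a]) (one_mem _) (const_mem_supp _ (τ a b))
  rwa [one_mul, one_mul, coeffSum_mul_const, ← etaCenter_smul, ← mul_smul_comm] at this

lemma sum_wordLists (τ : ι → ι → R) (hC : C.Nodup) (k : ℕ) (J : Finset ι) :
    ∑ L ∈ wordLists k C J, (L.map fun q => τ q.1 q.2).prod = coeffSum k (P τ J C) := by
  induction k, C, J using wordLists.induct with
  | case1 C J =>
    rw [wordLists, sum_singleton, List.map_nil, List.prod_nil]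
    induction C with
    | nil => simp [P, wordsProd, coeffSum_one]
    | cons a C ih =>
      rw [coeffSum_P_cons, Nat.cast_zero, sum_eq_zero, add_zero]
      · exact ih (List.nodup_cons.1 hC).2
      · intro b _
        rw [coeffSum_of_neg (by norm_num), mul_zero]
  | case2 k => simp [wordLists, P, wordsProd, coeffSum_one]; omega
  | case3 k a C J ih1 ih2 =>
    rw [sum_wordLists_cons (List.nodup_cons.1 hC).1, ih1 (List.nodup_cons.1 hC).2, coeffSum_P_cons]
    congr 1
    refine sum_congr rfl fun b _ => ?_
    have : ((k + 1 : ℕ) : ℤ) - 1 = k := by push_cast; ring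
    rw [this, ← ih2 b hC, mul_sum]
    simp

lemma sum_wordLists_reverse (τ : ι → ι → R) (hC : C.Nodup) (k : ℕ) (J : Finset ι) :
    ∑ L ∈ wordLists k C J, (L.reverse.map fun q => τ q.1 q.2).prod
      = coeffSum k (P τ J C.reverse) := by
  induction k, C, J using wordLists.induct with
  | case1 C J =>
    rw [wordLists, sum_singleton, List.reverse_nil, List.map_nil, List.prod_nil]
    induction C with
    | nil => simp [P, wordsProd, coeffSum_one]
    | cons a C ih =>
      rw [List.reverse_cons, coeffSum_P_concat, Nat.cast_zero, sum_eq_zero, add_zero]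
      · exact ih (List.nodup_cons.1 hC).2
      · intro b _
        rw [coeffSum_of_neg (by norm_num), zero_mul]
  | case2 k => simp [wordLists, P, wordsProd, coeffSum_one]; omega
  | case3 k a C J ih1 ih2 =>
    rw [sum_wordLists_cons (List.nodup_cons.1 hC).1, ih1 (List.nodup_cons.1 hC).2,
      List.reverse_cons, coeffSum_P_concat]
    congr 1
    refine sum_congr rfl fun b _ => ?_
    have : ((k + 1 : ℕ) : ℤ) - 1 = k := by push_cast; ring
    rw [this, ← List.reverse_cons, ← ih2 b hC, sum_mul]
    simp

end SetAlg

open Finset in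
lemma len_eq_sum {n : ℕ} (u : Perm (Fin n)) :
    (len n u : ℤ) = ∑ x, ∑ y, if x < y then (if u y < u x then 1 else 0) else 0 := by
  rw [len, card_filter, ← univ_product_univ, sum_product]
  push_cast
  simp only [ite_and]

open Finset in
lemma len_step {n : ℕ} (u : Perm (Fin n)) {i j : Fin n} (hij : i < j) (h : u i < u j) :
    len n (step n u (i, j)) = len n u + 1 + 2 * #{m | (i < m ∧ m < j) ∧ u i < u m ∧ u m < u j} := by
  set s := swap i j with hs
  have h1 : (len n (step n u (i, j)) : ℤ)
      = ∑ x, ∑ y, if s x < s y then (if u y < u x then 1 else 0) else 0 := by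
    rw [len_eq_sum, ← Equiv.sum_comp s]
    refine sum_congr rfl fun x _ => ?_
    rw [← Equiv.sum_comp s]
    simp [step, ← hs, s]
  have h2 : ∀ x y : Fin n, ((if s x < s y then (if u y < u x then 1 else 0) else 0 : ℤ))
      - (if x < y then (if u y < u x then 1 else 0) else 0)
      = (if x = i then (if i < y ∧ y < j then -(if u y < u i then 1 else 0) else 0) else 0)
      + (if y = i then (if i < x ∧ x < j then (if u i < u x then 1 else 0) else 0) else 0)
      + (if x = j then (if i < y ∧ y < j then (if u y < u j then 1 else 0) else 0) else 0)
      + (if y = j then (if i < x ∧ x < j then -(if u j < u x then 1 else 0) else 0) else 0)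
      + (if x = j then (if y = i then 1 else 0) else 0) := by
    intro x y
    simp only [hs, swap_apply_def]
    grind
  have h3 : (len n (step n u (i, j)) : ℤ) - len n u
      = 1 + ∑ m, if (i < m ∧ m < j) ∧ u i < u m ∧ u m < u j then (2 : ℤ) else 0 := by
    rw [h1, len_eq_sum]
    simp only [← sum_sub_distrib, h2]
    simp only [sum_add_distrib, sum_ite_irrel, sum_const_zero, sum_ite_eq', mem_univ, if_true]
    rw [add_comm, ← sum_add_distrib, ← sum_add_distrib, ← sum_add_distrib]
    congr 1
    refine sum_congr rfl fun m _ => ?_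
    by_cases hm : i < m ∧ m < j
    · have hi := u.injective.ne hm.1.ne
      have hj := u.injective.ne hm.2.ne
      simp only [hm, and_self, true_and, if_true]
      rcases lt_or_gt_of_ne hi with h4 | h4 <;> rcases lt_or_gt_of_ne hj with h5 | h5
      · simp [h4, h5, h4.not_gt, h5.not_gt]
      · simp [h4, h5, h4.not_gt, h5.not_gt]
      · simp [h4, h5, h4.not_gt, h5.not_gt]
      · exact absurd (h4.trans h) h5.not_gt
    · simp [hm]
  rw [← sum_filter, sum_const, nsmul_eq_mul] at h3
  omega

/-- `a, b, c` are distinct and appear in this cyclic order. -/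
def CyclicLT {α : Type*} [LT α] (a b c : α) : Prop :=
  (a < b ∧ b < c) ∨ (b < c ∧ c < a) ∨ (c < a ∧ a < b)

open Finset in
lemma isQBEdge_iff {n : ℕ} (u : Perm (Fin n)) (i j : Fin n) :
    isQBEdge n u (i, j) ↔ i < j ∧ ∀ m, i < m → m < j → ¬ CyclicLT (u i) (u m) (u j) := by
  refine and_congr_right fun hij => ?_
  change i < j at hij
  have hcard : ∀ p : Fin n → Prop, [DecidablePred p] →
      #{m | (i < m ∧ m < j) ∧ p m} ≤ (j : ℕ) - i - 1 ∧
      (#{m | (i < m ∧ m < j) ∧ p m} = (j : ℕ) - i - 1 ↔ ∀ m, i < m → m < j → p m) := by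
    intro p _
    have h1 : ({m | (i < m ∧ m < j) ∧ p m} : Finset (Fin n)) = {m ∈ Ioo i j | p m} := by
      ext; simp
    rw [h1, ← Fin.card_Ioo, card_filter_eq_iff]
    exact ⟨card_filter_le _ _, by simp⟩
  rcases lt_or_gt_of_ne (u.injective.ne hij.ne) with h | h
  · have h1 := len_step u hij h
    have h2 : #{m | (i < m ∧ m < j) ∧ u i < u m ∧ u m < u j} = 0 ↔
        ∀ m, i < m → m < j → ¬ CyclicLT (u i) (u m) (u j) := by
      rw [card_eq_zero, filter_eq_empty_iff]
      simp only [CyclicLT]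
      constructor
      · intro H m hm hm'
        have := @H m (mem_univ m)
        grind
      · intro H m _
        have := H m
        grind
    rw [← h2]
    simp only
    omega
  · have h1 := len_step (step n u (i, j)) hij (by simpa [step] using h)
    have h0 : step n (step n u (i, j)) (i, j) = u := by simp [step, mul_assoc]
    rw [h0] at h1
    have h3 := hcard fun m => step n u (i, j) i < step n u (i, j) m ∧
      step n u (i, j) m < step n u (i, j) j
    have h2 : (∀ m, i < m → m < j → step n u (i, j) i < step n u (i, j) m ∧
      step n u (i, j) m < step n u (i, j) j) ↔
        ∀ m, i < m → m < j → ¬ CyclicLT (u i) (u m) (u j) := by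
      refine forall_congr' fun m => forall_congr' fun hm => forall_congr' fun hm' => ?_
      have hi := u.injective.ne hm.ne
      have hj := u.injective.ne hm'.ne
      have hsm : step n u (i, j) m = u m := by simp [step, swap_apply_of_ne_of_ne hm.ne' hm'.ne]
      rw [hsm]
      simp only [step, CyclicLT, Perm.mul_apply, swap_apply_left, swap_apply_right]
      grind
    rw [← h2, ← h3.2]
    have := h3.1
    have hij' : (i : ℕ) < j := hij
    simp only
    omega

section CyclicLT

variable {α : Type*} [LinearOrder α] {a b c m : α}

lemma cyclicLT_swap (hab : a ≠ b) (hac : a ≠ c) (hbc : b ≠ c) :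
    CyclicLT a c b ↔ ¬ CyclicLT a b c := by
  simp only [CyclicLT]
  grind

lemma CyclicLT.rotate (h : CyclicLT a b c) : CyclicLT b c a := by
  simp only [CyclicLT] at *
  grind

lemma CyclicLT.iff_or (h : CyclicLT a b c) (hm : m ≠ b) :
    CyclicLT a m c ↔ CyclicLT a m b ∨ CyclicLT b m c := by
  simp only [CyclicLT] at *
  grind

end CyclicLT

section QuantumBruhat

variable {n : ℕ} {u : Perm (Fin n)} {i j k l : Fin n}

lemma isQBEdge_step_iff (u : Perm (Fin n)) (q : Fin n × Fin n) (i j : Fin n) :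
    isQBEdge n (step n u q) (i, j) ↔ i < j ∧ ∀ m, i < m → m < j →
      ¬ CyclicLT (u (swap q.1 q.2 i)) (u (swap q.1 q.2 m)) (u (swap q.1 q.2 j)) :=
  isQBEdge_iff _ i j

lemma isQBEdge_comm_of_disjoint (hik : i ≠ k) (hil : i ≠ l) (hjk : j ≠ k) (hjl : j ≠ l)
    (h : isQBEdge n u (i, j)) (h' : isQBEdge n (step n u (i, j)) (k, l)) :
    isQBEdge n u (k, l) ∧ isQBEdge n (step n u (k, l)) (i, j) := by
  rw [isQBEdge_iff] at h
  rw [isQBEdge_step_iff] at h'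
  rw [isQBEdge_iff, isQBEdge_step_iff]
  obtain ⟨hij, h⟩ := h
  obtain ⟨hkl, h'⟩ := h'
  simp only [swap_apply_of_ne_of_ne hik.symm hjk.symm,
    swap_apply_of_ne_of_ne hil.symm hjl.symm] at h'
  simp only [swap_apply_of_ne_of_ne hik hil, swap_apply_of_ne_of_ne hjk hjl]
  have a1 := u.injective.ne hik
  have a2 := u.injective.ne hil
  have a3 := u.injective.ne hjk
  have a4 := u.injective.ne hjl
  have a5 := u.injective.ne hij.ne
  have a6 := u.injective.ne hkl.ne
  refine ⟨⟨hkl, fun m hm hm' => ?_⟩, hij, fun m hm hm' => ?_⟩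
  · have h0 := h' m hm hm'
    by_cases hmi : m = i
    · subst hmi
      rw [swap_apply_left] at h0
      rcases lt_or_gt_of_ne hjl with hlt | hlt
      · simpa using h' j (hm.trans hij) hlt
      · have := h l hm' hlt
        simp only [CyclicLT] at *
        grind
    by_cases hmj : m = j
    · subst hmj
      rw [swap_apply_right] at h0
      rcases lt_or_gt_of_ne hik with hlt | hlt
      · have := h k hlt hm
        simp only [CyclicLT] at *
        grind
      · simpa using h' i hlt (hij.trans hm')
    · rwa [swap_apply_of_ne_of_ne hmi hmj] at h0
  · have h0 := h m hm hm'
    by_cases hmk : m = k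
    · subst hmk
      rw [swap_apply_left]
      rcases lt_or_gt_of_ne hjl with hlt | hlt
      · have := h' j hm' hlt
        rw [swap_apply_right] at this
        simp only [CyclicLT] at *
        grind
      · exact h l (hm.trans hkl) hlt
    by_cases hml : m = l
    · subst hml
      rw [swap_apply_right]
      rcases lt_or_gt_of_ne hik with hlt | hlt
      · exact h k hlt (hkl.trans hm')
      · have := h' i hlt hm
        rw [swap_apply_left] at this
        simp only [CyclicLT] at *
        grind
    · rwa [swap_apply_of_ne_of_ne hmk hml]

lemma forall_between_iff (hij : i < j) (hjk : j < k) (p : Fin n → Prop) :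
    (∀ m, i < m → m < k → p m) ↔
      (∀ m, i < m → m < j → p m) ∧ p j ∧ ∀ m, j < m → m < k → p m := by
  refine ⟨fun h => ⟨fun m h1 h2 => h m h1 (h2.trans hjk), h j hij hjk,
    fun m h1 h2 => h m (hij.trans h1) h2⟩, fun ⟨h1, h2, h3⟩ m hm hm' => ?_⟩
  rcases lt_trichotomy m j with h | rfl | h
  exacts [h1 m hm h, h2, h3 m h hm']

open Classical in
/-- The operator moving a function on permutations along the edges labeled `q`. -/
noncomputable def edgeOp (n : ℕ) (q : Fin n × Fin n) : Module.End ℤ (Perm (Fin n) → ℤ) where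
  toFun f u := if isQBEdge n u q then f (step n u q) else 0
  map_add' f g := by
    ext u
    by_cases h : isQBEdge n u q <;> simp [h]
  map_smul' c f := by
    ext u
    by_cases h : isQBEdge n u q <;> simp [h]

open Classical in
lemma edgeOp_apply (q : Fin n × Fin n) (f : Perm (Fin n) → ℤ) (u : Perm (Fin n)) :
    edgeOp n q f u = if isQBEdge n u q then f (step n u q) else 0 := rfl

open Classical in
lemma edgeOp_mul_apply (q r : Fin n × Fin n) (f : Perm (Fin n) → ℤ) (u : Perm (Fin n)) :
    (edgeOp n q * edgeOp n r) f u =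
      if isQBEdge n u q ∧ isQBEdge n (step n u q) r then f (u * (swap q.1 q.2 * swap r.1 r.2))
      else 0 := by
  rw [Module.End.mul_apply, edgeOp_apply, edgeOp_apply, ite_and, ← mul_assoc]
  rfl

lemma edgeOp_commute (hik : i ≠ k) (hil : i ≠ l) (hjk : j ≠ k) (hjl : j ≠ l) :
    Commute (edgeOp n (i, j)) (edgeOp n (k, l)) := by
  refine LinearMap.ext fun f => funext fun u => ?_
  rw [edgeOp_mul_apply, edgeOp_mul_apply]
  have hc : Commute (swap i j) (swap k l) := by
    refine Perm.Disjoint.commute fun x => ?_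
    by_cases hi : x = i
    · subst hi; exact Or.inr (swap_apply_of_ne_of_ne hik hil)
    by_cases hj : x = j
    · subst hj; exact Or.inr (swap_apply_of_ne_of_ne hjk hjl)
    exact Or.inl (swap_apply_of_ne_of_ne hi hj)
  rw [hc.eq]
  congr 1
  refine propext ⟨fun h => ?_, fun h => ?_⟩
  · exact isQBEdge_comm_of_disjoint hik hil hjk hjl h.1 h.2
  · exact isQBEdge_comm_of_disjoint hik.symm hjk.symm hil.symm hjl.symm h.1 h.2

lemma edgeOp_sq (hij : i < j) :
    edgeOp n (i, j) * edgeOp n (i, j) = if (i : ℕ) + 1 = j then 1 else 0 := by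
  refine LinearMap.ext fun f => funext fun u => ?_
  rw [edgeOp_mul_apply]
  have h : isQBEdge n u (i, j) ∧ isQBEdge n (step n u (i, j)) (i, j) ↔ (i : ℕ) + 1 = j := by
    rw [isQBEdge_iff, isQBEdge_step_iff]
    simp only [hij, true_and, swap_apply_left, swap_apply_right]
    refine ⟨fun h => ?_, fun h => ?_⟩
    · by_contra hne
      have hlt : (i : ℕ) + 1 < j := by
        have : (i : ℕ) < j := hij
        omega
      let m : Fin n := ⟨i + 1, hlt.trans j.isLt⟩
      have hm : i < m := Fin.lt_def.2 (Nat.lt_succ_self _)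
      have hm' : m < j := Fin.lt_def.2 hlt
      have h1 := h.1 m hm hm'
      have h2 := h.2 m hm hm'
      rw [swap_apply_of_ne_of_ne hm.ne' hm'.ne] at h2
      have a1 := u.injective.ne hm.ne
      have a2 := u.injective.ne hm'.ne
      have a3 := u.injective.ne hij.ne
      simp only [CyclicLT] at *
      grind
    · have (m : Fin n) (hm : i < m) (hm' : m < j) : False := by
        rw [Fin.lt_def] at hm hm'
        omega
      exact ⟨fun m hm hm' => (this m hm hm').elim, fun m hm hm' => (this m hm hm').elim⟩
  simp only [h, swap_mul_self, mul_one]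
  split_ifs <;> rfl

lemma forall_not_cyclicLT_swap_iff {a b c d p q : Fin n} (hp : ¬ (a < p ∧ p < b))
    (hq : ¬ (a < q ∧ q < b)) :
    (∀ m, a < m → m < b → ¬ CyclicLT (u c) (u (swap p q m)) (u d)) ↔
      ∀ m, a < m → m < b → ¬ CyclicLT (u c) (u m) (u d) := by
  refine forall₃_congr fun m hm hm' => ?_
  have hmp : m ≠ p := by rintro rfl; exact hp ⟨hm, hm'⟩
  have hmq : m ≠ q := by rintro rfl; exact hq ⟨hm, hm'⟩
  rw [swap_apply_of_ne_of_ne hmp hmq]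

lemma CyclicLT.forall_between_iff {a b c d e : Fin n} (h : CyclicLT (u c) (u d) (u e))
    (hd : ¬ (a < d ∧ d < b)) :
    (∀ m, a < m → m < b → ¬ CyclicLT (u c) (u m) (u e)) ↔
      (∀ m, a < m → m < b → ¬ CyclicLT (u c) (u m) (u d)) ∧
        ∀ m, a < m → m < b → ¬ CyclicLT (u d) (u m) (u e) := by
  simp only [← forall_and, ← not_or]
  refine forall₃_congr fun m hm hm' => ?_
  rw [h.iff_or]
  refine u.injective.ne ?_
  rintro rfl
  exact hd ⟨hm, hm'⟩

lemma ite_eq_ite_add_ite {A B C : Prop} [Decidable A] [Decidable B] [Decidable C] {x : ℤ}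
    (h : (A ↔ B ∨ C) ∧ ¬ (B ∧ C)) :
    (if A then x else 0) = (if B then x else 0) + if C then x else 0 := by
  split_ifs <;> simp_all

lemma edgeOp_mul_of_lt (hij : i < j) (hjk : j < k) :
    edgeOp n (i, j) * edgeOp n (j, k) =
      edgeOp n (j, k) * edgeOp n (i, k) + edgeOp n (i, k) * edgeOp n (i, j) := by
  refine LinearMap.ext fun f => funext fun u => ?_
  have hik := hij.trans hjk
  rw [LinearMap.add_apply, Pi.add_apply, edgeOp_mul_apply, edgeOp_mul_apply, edgeOp_mul_apply]
  have e1 : swap j k * swap i k = swap i j * swap j k := by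
    ext x; simp only [Perm.mul_apply, swap_apply_def]; grind
  have e2 : swap i k * swap i j = swap i j * swap j k := by
    ext x; simp only [Perm.mul_apply, swap_apply_def]; grind
  have g1 : ¬ (j < i ∧ i < k) := fun h => h.1.asymm hij
  have g2 : ¬ (i < k ∧ k < j) := fun h => h.2.asymm hjk
  have g3 {a b : Fin n} : ¬ (a < a ∧ a < b) := fun h => h.1.false
  have g4 {a b : Fin n} : ¬ (a < b ∧ b < b) := fun h => h.2.false
  rw [e1, e2]
  classical
  apply ite_eq_ite_add_ite
  simp only [isQBEdge_iff u, isQBEdge_step_iff u, hij, hjk, hik, true_and,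
    forall_between_iff hij hjk, swap_apply_left, swap_apply_right,
    swap_apply_of_ne_of_ne hij.ne hik.ne, swap_apply_of_ne_of_ne hik.ne' hjk.ne',
    swap_apply_of_ne_of_ne hij.ne' hjk.ne, forall_not_cyclicLT_swap_iff g1 g3,
    forall_not_cyclicLT_swap_iff g3 g4, forall_not_cyclicLT_swap_iff g3 g2,
    forall_not_cyclicLT_swap_iff g4 g2]
  have hij' := u.injective.ne hij.ne
  have hjk' := u.injective.ne hjk.ne
  have hik' := u.injective.ne hik.ne
  by_cases h : CyclicLT (u i) (u j) (u k)
  · have h' : ¬ CyclicLT (u i) (u k) (u j) := by rwa [cyclicLT_swap hij' hik' hjk', not_not]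
    simp only [h, h', h.forall_between_iff g3]
    tauto
  · have h' : CyclicLT (u i) (u k) (u j) := by rwa [cyclicLT_swap hij' hik' hjk']
    simp only [h, h', h'.forall_between_iff g2]
    tauto

lemma edgeOp_mul_of_lt' (hij : i < j) (hjk : j < k) :
    edgeOp n (j, k) * edgeOp n (i, j) =
      edgeOp n (i, k) * edgeOp n (j, k) + edgeOp n (i, j) * edgeOp n (i, k) := by
  refine LinearMap.ext fun f => funext fun u => ?_
  have hik := hij.trans hjk
  rw [LinearMap.add_apply, Pi.add_apply, edgeOp_mul_apply, edgeOp_mul_apply, edgeOp_mul_apply]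
  have e1 : swap i k * swap j k = swap j k * swap i j := by
    ext x; simp only [Perm.mul_apply, swap_apply_def]; grind
  have e2 : swap i j * swap i k = swap j k * swap i j := by
    ext x; simp only [Perm.mul_apply, swap_apply_def]; grind
  have g1 : ¬ (j < i ∧ i < k) := fun h => h.1.asymm hij
  have g2 : ¬ (i < k ∧ k < j) := fun h => h.2.asymm hjk
  have g3 {a b : Fin n} : ¬ (a < a ∧ a < b) := fun h => h.1.false
  have g4 {a b : Fin n} : ¬ (a < b ∧ b < b) := fun h => h.2.false
  rw [e1, e2]
  classical
  apply ite_eq_ite_add_ite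
  simp only [isQBEdge_iff u, isQBEdge_step_iff u, hij, hjk, hik, true_and,
    forall_between_iff hij hjk, swap_apply_left, swap_apply_right,
    swap_apply_of_ne_of_ne hij.ne hik.ne, swap_apply_of_ne_of_ne hik.ne' hjk.ne',
    swap_apply_of_ne_of_ne hij.ne' hjk.ne, forall_not_cyclicLT_swap_iff g1 g3,
    forall_not_cyclicLT_swap_iff g3 g4, forall_not_cyclicLT_swap_iff g1 g4, forall_not_cyclicLT_swap_iff g4 g2]
  have hij' := u.injective.ne hij.ne
  have hjk' := u.injective.ne hjk.ne
  have hik' := u.injective.ne hik.ne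
  by_cases h : CyclicLT (u i) (u j) (u k)
  · have h' : ¬ CyclicLT (u j) (u i) (u k) := fun h' =>
      (cyclicLT_swap hjk' hij'.symm hik'.symm).1 h' h.rotate
    simp only [h, h', h.forall_between_iff g4]
    tauto
  · have h' : CyclicLT (u j) (u i) (u k) := by
      rw [cyclicLT_swap hjk' hij'.symm hik'.symm]
      exact fun h' => h h'.rotate.rotate
    simp only [h, h', h'.forall_between_iff g1]
    tauto

/-- The antisymmetric extension of the edge operators to all pairs of positions. -/
noncomputable def signedEdgeOp (n : ℕ) (i j : Fin n) : Module.End ℤ (Perm (Fin n) → ℤ) :=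
  if i < j then edgeOp n (i, j) else if j < i then -edgeOp n (j, i) else 0

lemma signedEdgeOp_of_lt (h : i < j) : signedEdgeOp n i j = edgeOp n (i, j) := if_pos h

lemma signedEdgeOp_of_gt (h : j < i) : signedEdgeOp n i j = -edgeOp n (j, i) := by
  rw [signedEdgeOp, if_neg h.not_gt, if_pos h]

lemma isBracketFamily_signedEdgeOp (n : ℕ) :
    IsBracketFamily (signedEdgeOp n)
      fun i j => if (i : ℕ) + 1 = j ∨ (j : ℕ) + 1 = i then 1 else 0 where
  self i := by simp [signedEdgeOp]
  anti i j := by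
    rcases lt_trichotomy i j with h | rfl | h
    · rw [signedEdgeOp_of_lt h, signedEdgeOp_of_gt h, neg_neg]
    · simp [signedEdgeOp]
    · rw [signedEdgeOp_of_lt h, signedEdgeOp_of_gt h]
  sq i j h := by
    rcases lt_or_gt_of_ne h with h | h
    · have h' : ¬ (j : ℕ) + 1 = i := by
        have : (i : ℕ) < j := h
        omega
      rw [signedEdgeOp_of_lt h, edgeOp_sq h]
      split_ifs <;> simp_all
    · have h' : ¬ (i : ℕ) + 1 = j := by
        have : (j : ℕ) < i := h
        omega
      rw [signedEdgeOp_of_gt h, neg_mul_neg, edgeOp_sq h]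
      split_ifs <;> simp_all
  comm i j k l hik hil hjk hjl := by
    simp only [signedEdgeOp]
    have h1 := edgeOp_commute hik hil hjk hjl
    have h2 := edgeOp_commute hil hik hjl hjk
    have h3 := edgeOp_commute hjk hjl hik hil
    have h4 := edgeOp_commute hjl hjk hil hik
    split_ifs <;> simp [h1, h2, h3, h4]
  bracket c x y hcx hcy hxy := by
    rcases lt_or_gt_of_ne hcx with h1 | h1 <;> rcases lt_or_gt_of_ne hcy with h2 | h2 <;>
      rcases lt_or_gt_of_ne hxy with h3 | h3
    all_goals try exact absurd (h1.trans h3) h2.not_gt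
    all_goals try exact absurd (h2.trans h3) h1.not_gt
    all_goals
      simp only [signedEdgeOp_of_lt, signedEdgeOp_of_gt, h1, h2, h3, neg_mul, mul_neg, neg_neg,
        sub_neg_eq_add, edgeOp_mul_of_lt, edgeOp_mul_of_lt']
      abel

lemma isQBEdge_wo_mul_step (u : Perm (Fin n)) (q : Fin n × Fin n) :
    isQBEdge n (wo n * step n u q) q ↔ isQBEdge n u q := by
  obtain ⟨i, j⟩ := q
  rw [isQBEdge_iff, isQBEdge_iff]
  refine and_congr_right fun _ => forall₃_congr fun m hm hm' => not_congr ?_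
  have h (x : Fin n) : wo n x = x.rev := rfl
  simp only [Perm.mul_apply, step, swap_apply_left, swap_apply_right,
    swap_apply_of_ne_of_ne hm.ne' hm'.ne, h, CyclicLT, Fin.rev_lt_rev]
  tauto

lemma wo_mul_wo : wo n * wo n = 1 := by
  ext x
  exact congrArg Fin.val (Fin.rev_rev x)

lemma step_step (u : Perm (Fin n)) (q : Fin n × Fin n) : step n (step n u q) q = u := by
  simp [step, mul_assoc]

lemma isPath_append (u v : Perm (Fin n)) (L M : List (Fin n × Fin n)) :
    isPath n u (L ++ M) v ↔ ∃ x, isPath n u L x ∧ isPath n x M v := by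
  induction L generalizing u with
  | nil => simp [isPath]
  | cons q L ih => simp [isPath, ih, and_assoc]

lemma isPath_reverse_iff (u v : Perm (Fin n)) (L : List (Fin n × Fin n)) :
    isPath n (wo n * v) L.reverse (wo n * u) ↔ isPath n u L v := by
  induction L generalizing u with
  | nil => simp [isPath, eq_comm]
  | cons q L ih =>
    rw [List.reverse_cons, isPath_append]
    simp only [isPath]
    rw [← ih, ← isQBEdge_wo_mul_step]
    have hx (x : Perm (Fin n)) : step n x q = wo n * u ↔ x = wo n * step n u q := by
      constructor
      · intro h
        rw [← step_step x q, h]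
        exact mul_assoc _ _ _
      · rintro rfl
        rw [show wo n * step n u q = step n (wo n * u) q from (mul_assoc _ _ _).symm, step_step]
    simp only [hx]
    constructor
    · rintro ⟨x, h1, h2, rfl⟩
      exact ⟨h2, h1⟩
    · rintro ⟨h2, h1⟩
      exact ⟨_, h1, h2, rfl⟩

open Classical in
lemma prod_edgeOp_single_apply (u v : Perm (Fin n)) (L : List (Fin n × Fin n)) :
    (L.map (edgeOp n)).prod (Pi.single v 1) u = if isPath n u L v then 1 else 0 := by
  induction L generalizing u with
  | nil =>
    simp only [isPath, List.map_nil, List.prod_nil, Module.End.one_apply, Pi.single_apply]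
    congr
  | cons q L ih =>
    rw [List.map_cons, List.prod_cons, Module.End.mul_apply, edgeOp_apply, ih, ← ite_and]
    simp only [isPath]
    congr

end QuantumBruhat

section ConcatLists

variable {α : Type*} [DecidableEq α]

/-- All concatenations of one list from each of the given sets, in order. -/
def concatLists : List (Finset (List α)) → Finset (List α)
  | [] => {[]}
  | A :: As => (A ×ˢ concatLists As).image fun p => p.1 ++ p.2

lemma mem_concatLists_ofFn {m : ℕ} (A : Fin m → Finset (List α)) (L : List α) :
    L ∈ concatLists (List.ofFn A) ↔
      ∃ Ls : Fin m → List α, L = (List.ofFn Ls).flatten ∧ ∀ k, Ls k ∈ A k := by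
  induction m generalizing L with
  | zero => simp [concatLists]
  | succ m ih =>
    rw [List.ofFn_succ, concatLists]
    simp only [Finset.mem_image, Finset.mem_product, Prod.exists, ih, Fin.forall_fin_succ,
      List.ofFn_succ, List.flatten_cons]
    constructor
    · rintro ⟨a, b, ⟨ha, Ls, rfl, hLs⟩, rfl⟩
      exact ⟨Fin.cons a Ls, by simp, by simpa using ha, by simpa using hLs⟩
    · rintro ⟨Ls, rfl, h0, hs⟩
      exact ⟨Ls 0, _, ⟨h0, _, rfl, hs⟩, rfl⟩

variable {R : Type*} [Semiring R]

lemma sum_concatLists_cons {A : Finset (List α)} {l : ℕ} (hA : ∀ L ∈ A, L.length = l)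
    (As : List (Finset (List α))) (g : List α → R) :
    ∑ L ∈ concatLists (A :: As), g L = ∑ L ∈ A, ∑ M ∈ concatLists As, g (L ++ M) := by
  rw [concatLists, Finset.sum_image, Finset.sum_product]
  rintro ⟨L, M⟩ h ⟨L', M'⟩ h' e
  simp only [Finset.coe_product, Set.mem_prod, Finset.mem_coe] at h h'
  obtain ⟨rfl, rfl⟩ := List.append_inj e ((hA _ h.1).trans (hA _ h'.1).symm)
  rfl

lemma sum_concatLists (f : α → R) (As : List (Finset (List α)))
    (hAs : ∀ A ∈ As, ∃ l, ∀ L ∈ A, L.length = l) :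
    ∑ L ∈ concatLists As, (L.map f).prod = (As.map fun A => ∑ L ∈ A, (L.map f).prod).prod := by
  induction As with
  | nil => simp [concatLists]
  | cons A As ih =>
    obtain ⟨l, hl⟩ := hAs A List.mem_cons_self
    rw [sum_concatLists_cons hl, List.map_cons, List.prod_cons,
      ← ih fun B hB => hAs B (List.mem_cons_of_mem _ hB), Finset.sum_mul_sum]
    simp only [List.map_append, List.prod_append]

lemma sum_concatLists_reverse (f : α → R) (As : List (Finset (List α)))
    (hAs : ∀ A ∈ As, ∃ l, ∀ L ∈ A, L.length = l) :
    ∑ L ∈ concatLists As, (L.reverse.map f).prod =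
      (As.map fun A => ∑ L ∈ A, (L.reverse.map f).prod).reverse.prod := by
  induction As with
  | nil => simp [concatLists]
  | cons A As ih =>
    obtain ⟨l, hl⟩ := hAs A List.mem_cons_self
    rw [sum_concatLists_cons hl, List.map_cons, List.reverse_cons, List.prod_append,
      List.prod_singleton, ← ih fun B hB => hAs B (List.mem_cons_of_mem _ hB), Finset.sum_mul_sum,
      Finset.sum_comm]
    simp only [List.reverse_append, List.map_append, List.prod_append]

end ConcatLists

section Admissible

variable {n : ℕ}

/-- The label sequences of `y_k^l`-admissible paths. -/
def admWords (n : ℕ) (k : Fin (n - 1)) (l : ℕ) : Finset (List (Fin n × Fin n)) :=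
  SetAlg.wordLists l ((List.finRange n).filter fun a => (a : ℕ) ≤ k)
    (Finset.univ.filter fun b : Fin n => (k : ℕ) < b)

lemma mem_admWords {k : Fin (n - 1)} {l : ℕ} {L : List (Fin n × Fin n)} :
    L ∈ admWords n k l ↔ L.length = l ∧ yAdm n k L := by
  have h : List.Chain' (· ≤ ·) (L.map Prod.fst) ↔ (L.map Prod.fst).Pairwise (· ≤ ·) :=
    List.isChain_iff_pairwise
  rw [admWords, SetAlg.mem_wordLists ((List.pairwise_lt_finRange n).filter _), yAdm, h]
  simp

/-- The sum of the path operators over all `y_k^l`-admissible label sequences. -/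
noncomputable def admOp (n : ℕ) (k : Fin (n - 1)) (l : ℕ) : Module.End ℤ (Perm (Fin n) → ℤ) :=
  ∑ L ∈ admWords n k l, (L.map (edgeOp n)).prod

lemma map_edgeOp_of_mem_admWords {k : Fin (n - 1)} {l : ℕ} {L : List (Fin n × Fin n)}
    (hL : L ∈ admWords n k l) :
    L.map (edgeOp n) = L.map fun q => signedEdgeOp n q.1 q.2 := by
  refine List.map_congr_left fun q hq => (signedEdgeOp_of_lt ?_).symm
  have h := (mem_admWords.1 hL).2.2.1 q hq
  exact Fin.lt_def.2 (h.1.trans_lt h.2)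

lemma admOp_eq (k : Fin (n - 1)) (l : ℕ) :
    admOp n k l = SetAlg.coeffSum l (SetAlg.P (signedEdgeOp n)
      (Finset.univ.filter fun b : Fin n => (k : ℕ) < b)
      ((List.finRange n).filter fun a => (a : ℕ) ≤ k)) := by
  rw [← SetAlg.sum_wordLists _ ((List.nodup_finRange n).filter _), admOp]
  exact Finset.sum_congr rfl fun L hL => by rw [map_edgeOp_of_mem_admWords hL]

lemma sum_reverse_admWords (k : Fin (n - 1)) (l : ℕ) :
    ∑ L ∈ admWords n k l, (L.reverse.map (edgeOp n)).prod = admOp n k l := by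
  rw [admOp_eq, ← SetAlg.P_reverse (isBracketFamily_signedEdgeOp n)
    ((List.nodup_finRange n).filter _) (by simp),
    ← SetAlg.sum_wordLists_reverse _ ((List.nodup_finRange n).filter _)]
  exact Finset.sum_congr rfl fun L hL => by
    rw [List.map_reverse, List.map_reverse, map_edgeOp_of_mem_admWords hL]

lemma admOp_commute (k k' : Fin (n - 1)) (l l' : ℕ) : Commute (admOp n k l) (admOp n k' l') := by
  rw [admOp_eq, admOp_eq]
  exact SetAlg.commute_coeffSum_P (isBracketFamily_signedEdgeOp n)
    ((List.nodup_finRange n).filter _) (by simp) ((List.nodup_finRange n).filter _) (by simp) _ _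

/-- The label sequences of `y^β`-admissible paths. -/
def betaAdmWords (n : ℕ) (β : Fin (n - 1) → ℕ) : Finset (List (Fin n × Fin n)) :=
  concatLists (List.ofFn fun k => admWords n k (β k))

lemma mem_betaAdmWords {β : Fin (n - 1) → ℕ} {L : List (Fin n × Fin n)} :
    L ∈ betaAdmWords n β ↔ yBetaAdm n β L := by
  simp only [betaAdmWords, mem_concatLists_ofFn, mem_admWords, yBetaAdm]

lemma sum_betaAdmWords_reverse (β : Fin (n - 1) → ℕ) :
    ∑ L ∈ betaAdmWords n β, (L.reverse.map (edgeOp n)).prod =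
      ∑ L ∈ betaAdmWords n β, (L.map (edgeOp n)).prod := by
  have h : ∀ A ∈ List.ofFn fun k => admWords n k (β k), ∃ l, ∀ L ∈ A, L.length = l := by
    intro A hA
    obtain ⟨k, rfl⟩ := List.mem_ofFn.1 hA
    exact ⟨β k, fun L hL => (mem_admWords.1 hL).1⟩
  rw [betaAdmWords, sum_concatLists_reverse _ _ h, sum_concatLists _ _ h, List.map_ofFn,
    List.map_ofFn]
  simp only [Function.comp_def, sum_reverse_admWords]
  refine (List.reverse_perm _).prod_eq' ?_
  rw [List.pairwise_reverse, List.pairwise_ofFn]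
  exact fun i j _ => admOp_commute _ _ _ _

open Classical in
lemma ncard_isPath (β : Fin (n - 1) → ℕ) (p : List (Fin n × Fin n) → Prop) :
    (({L | p L ∧ yBetaAdm n β L}.ncard : ℕ) : ℤ) =
      ∑ L ∈ betaAdmWords n β, if p L then 1 else 0 := by
  have h : {L | p L ∧ yBetaAdm n β L} = ((betaAdmWords n β).filter p : Set _) := by
    ext L
    simp [mem_betaAdmWords, and_comm]
  rw [h, Set.ncard_coe_finset, Finset.sum_boole]

end Admissible

/-- For every `w ∈ S_n` and every `β`, the number of `y^β`-admissible directed paths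
in `Γ_n` from `w` to the longest permutation `w_o` equals the number of
`y^β`-admissible directed paths from the identity to `w_o·w`. -/
theorem count_admissible_paths_to_wo (n : ℕ) (hn : 2 ≤ n)
    (w : Equiv.Perm (Fin n)) (β : Fin (n - 1) → ℕ) :
    {L : List (Fin n × Fin n) | isPath n w L (wo n) ∧ yBetaAdm n β L}.ncard =
    {L : List (Fin n × Fin n) | isPath n 1 L (wo n * w) ∧ yBetaAdm n β L}.ncard := by
  classical
  have h := congrFun (DFunLike.congr_fun (sum_betaAdmWords_reverse β) (Pi.single (wo n * w) 1)) 1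
  simp only [LinearMap.sum_apply, Finset.sum_apply, prod_edgeOp_single_apply] at h
  rw [← Nat.cast_inj (R := ℤ), ncard_isPath, ncard_isPath, ← h]
  refine Finset.sum_congr rfl fun L _ => ?_
  rw [← isPath_reverse_iff, wo_mul_wo]
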